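/- Let F be a field of characteristic 2, let φ be an anisotropic quadratic form over F of dimension 5 and type (1,3) that is not a Pfister neighbour, and let ψ be an anisotropic totally singular quadratic form over F of dimension s ≥ 5 (i.e. of type (0,s)). Then the scalar extension φ_{F(ψ)} of φ to the function field F(ψ) is anisotropic. -/

import Mathlib

open QuadraticMap MvPolynomial
open scoped TensorProduct

set_option synthInstance.maxHeartbeats 1000000
set_option maxHeartbeats 1000000


section Defs

variable {K : Type} [CommRing K]

/-- The binary quadratic form `[a,b] : (x,y) ↦ a·x² + x·y + b·y²`. -/
noncomputable def binQF (a b : K) : QuadraticForm K (Fin 2 → K) :=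
  (Matrix.of ![![a, 1], ![0, b]]).toQuadraticMap'

/-- The diagonal (totally singular) quadratic form `⟨c₁, …, c_s⟩`. -/
noncomputable def diagQF {s : ℕ} (c : Fin s → K) : QuadraticForm K (Fin s → K) :=
  QuadraticMap.weightedSumSquares K c

/-- The orthogonal sum `[a₁,b₁] ⊥ ⋯ ⊥ [a_r,b_r]` of binary forms. -/
noncomputable def binsQF {r : ℕ} (a b : Fin r → K) : QuadraticForm K (Fin r → Fin 2 → K) :=
  QuadraticMap.pi fun i => binQF (a i) (b i)

/-- The orthogonal sum of `m` hyperbolic planes `[0,0]`. -/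
noncomputable def hypQF (K : Type) [CommRing K] (m : ℕ) :
    QuadraticForm K (Fin m → Fin 2 → K) :=
  binsQF (fun _ => 0) (fun _ => 0)

/-- The `(n+1)`-fold quadratic Pfister form `⟨⟨a₁,…,aₙ⟩⟩_b ⊗ [1,c]`, i.e. the orthogonal
sum over all subsets `S ⊆ {1,…,n}` of `(∏_{i∈S} aᵢ)·[1,c]`. -/
noncomputable def pfisterQF (n : ℕ) (a : Fin n → K) (c : K) :
    QuadraticForm K (Finset (Fin n) → Fin 2 → K) :=
  QuadraticMap.pi fun S : Finset (Fin n) => (∏ i ∈ S, a i) • binQF 1 c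

variable {V W : Type} [AddCommGroup V] [Module K V] [AddCommGroup W] [Module K W]

/-- `φ` has type `(r,s)`: it is isometric to `[a₁,b₁] ⊥ ⋯ ⊥ [a_r,b_r] ⊥ ⟨c₁,…,c_s⟩`. -/
def HasTypeRS (φ : QuadraticForm K V) (r s : ℕ) : Prop :=
  ∃ (a b : Fin r → K) (c : Fin s → K), φ.Equivalent ((binsQF a b).prod (diagQF c))

/-- `φ` is dominated by `ψ`. -/
def Dominated (φ : QuadraticForm K V) (ψ : QuadraticForm K W) : Prop :=
  ∃ f : V →ₗ[K] W, Function.Injective f ∧ ∀ v, φ v = ψ (f v)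

/-- `φ` is weakly dominated by `ψ`: `α·φ` is dominated by `ψ` for some unit `α`. -/
def WeaklyDominated (φ : QuadraticForm K V) (ψ : QuadraticForm K W) : Prop :=
  ∃ α : Kˣ, Dominated ((α : K) • φ) ψ

/-- Witt equivalence of quadratic forms. -/
def WittEquiv (Q₁ : QuadraticForm K V) (Q₂ : QuadraticForm K W) : Prop :=
  ∃ k l : ℕ, (Q₁.prod (hypQF K k)).Equivalent (Q₂.prod (hypQF K l))

/-- `φ` is a Pfister neighbour: there is a quadratic Pfister form `π` with
`2·dim φ > dim π` and `φ ≺_w π`. -/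
def IsPfisterNeighbour (φ : QuadraticForm K V) : Prop :=
  ∃ (n : ℕ) (a : Fin n → Kˣ) (c : K),
    2 * Module.finrank K V > 2 ^ (n + 1) ∧
      WeaklyDominated φ (pfisterQF n (fun i => (a i : K)) c)

/-- The Artin–Schreier set `℘(K) = {t² + t : t ∈ K}`. -/
def ArtinSchreier (K : Type) [CommRing K] : Set K := {x : K | ∃ t : K, x = t ^ 2 + t}

end Defs

section FunField

variable (F : Type) [Field F]

/-- The coefficient matrix of a quadratic form on `Fin n → F` with respect to the
standard basis: diagonal entries `ψ(eᵢ)`, above-diagonal entries `b_ψ(eᵢ,eⱼ)`. -/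
noncomputable def coeffMat {n : ℕ} (ψ : QuadraticForm F (Fin n → F)) :
    Matrix (Fin n) (Fin n) F :=
  Matrix.of fun i j =>
    if i = j then ψ (Pi.single i 1)
    else if i < j then polar ψ (Pi.single i 1) (Pi.single j 1) else 0

/-- The homogeneous degree 2 polynomial `P_ψ` associated to a quadratic form `ψ`. -/
noncomputable def qfPoly {n : ℕ} (ψ : QuadraticForm F (Fin n → F)) :
    MvPolynomial (Fin n) F :=
  ∑ i : Fin n, ∑ j : Fin n, MvPolynomial.C (coeffMat F ψ i j) * (X i * X j)

/-- The affine coordinate ring `F[x₁,…,xₙ]/(P_ψ)` of the quadric `ψ = 0`. -/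
def FunFieldRing {n : ℕ} (ψ : QuadraticForm F (Fin n → F)) : Type :=
  MvPolynomial (Fin n) F ⧸ Ideal.span {qfPoly F ψ}

noncomputable instance {n : ℕ} (ψ : QuadraticForm F (Fin n → F)) :
    CommRing (FunFieldRing F ψ) :=
  inferInstanceAs (CommRing (MvPolynomial (Fin n) F ⧸ Ideal.span {qfPoly F ψ}))

noncomputable instance {n : ℕ} (ψ : QuadraticForm F (Fin n → F)) :
    Algebra F (FunFieldRing F ψ) :=
  inferInstanceAs (Algebra F (MvPolynomial (Fin n) F ⧸ Ideal.span {qfPoly F ψ}))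

/-- The function field `F(ψ)` of the quadric `ψ = 0`. -/
def FunField {n : ℕ} (ψ : QuadraticForm F (Fin n → F)) : Type :=
  FractionRing (FunFieldRing F ψ)

noncomputable instance {n : ℕ} (ψ : QuadraticForm F (Fin n → F)) :
    CommRing (FunField F ψ) :=
  inferInstanceAs (CommRing (FractionRing (FunFieldRing F ψ)))

noncomputable instance {n : ℕ} (ψ : QuadraticForm F (Fin n → F)) :
    Algebra (FunFieldRing F ψ) (FunField F ψ) :=
  inferInstanceAs (Algebra (FunFieldRing F ψ) (FractionRing (FunFieldRing F ψ)))

noncomputable instance {n : ℕ} (ψ : QuadraticForm F (Fin n → F)) :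
    Algebra F (FunField F ψ) :=
  inferInstanceAs (Algebra F (FractionRing (FunFieldRing F ψ)))

/-- The canonical map `F → F(ψ)`. -/
noncomputable def funFieldMap {n : ℕ} (ψ : QuadraticForm F (Fin n → F)) :
    F →+* FunField F ψ :=
  algebraMap F (FunField F ψ)

/-- Scalar extension of a quadratic form on `Fin n → F` along a ring homomorphism
`f : F → K`. -/
noncomputable def extendQF {K : Type} [CommRing K] (f : F →+* K) {n : ℕ}
    (φ : QuadraticForm F (Fin n → F)) : QuadraticForm K (Fin n → K) :=
  ((coeffMat F φ).map f).toQuadraticMap'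

end FunField


section Quat

variable (K : Type) [CommRing K]

/-- Defining relations for the char-2 quaternion algebra `[a,b)`: generators `i,j` with
`i² + i = a`, `j² = b`, `j·i = i·j + j` (i.e. `j·i·j⁻¹ = i + 1`). -/
inductive QuatRel (a b : K) : FreeAlgebra K (Fin 2) → FreeAlgebra K (Fin 2) → Prop
  | i_sq : QuatRel a b (FreeAlgebra.ι K 0 * FreeAlgebra.ι K 0 + FreeAlgebra.ι K 0)
      (algebraMap K _ a)
  | j_sq : QuatRel a b (FreeAlgebra.ι K 1 * FreeAlgebra.ι K 1) (algebraMap K _ b)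
  | swap : QuatRel a b (FreeAlgebra.ι K 1 * FreeAlgebra.ι K 0)
      (FreeAlgebra.ι K 0 * FreeAlgebra.ι K 1 + FreeAlgebra.ι K 1)

/-- The quaternion algebra `[a,b)` over `K` (characteristic two convention). -/
def QuatAlg (a b : K) : Type := RingQuot (QuatRel K a b)

noncomputable instance (a b : K) : Ring (QuatAlg K a b) :=
  inferInstanceAs (Ring (RingQuot (QuatRel K a b)))
noncomputable instance (a b : K) : Algebra K (QuatAlg K a b) :=
  inferInstanceAs (Algebra K (RingQuot (QuatRel K a b)))

/-- `[a,b)` is split over `K`: isomorphic to the `2×2` matrix algebra. -/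
def QuatSplit (a b : K) : Prop :=
  Nonempty (QuatAlg K a b ≃ₐ[K] Matrix (Fin 2) (Fin 2) K)

end Quat

section Sqrt

variable (F : Type) [Field F]

/-- The field `F(√c₁,…,√c_s)` obtained by adjoining square roots of the `cᵢ`
(inside an algebraic closure of `F`). -/
noncomputable def sqrtExt {s : ℕ} (c : Fin s → F) :
    IntermediateField F (AlgebraicClosure F) :=
  IntermediateField.adjoin F
    {y : AlgebraicClosure F | ∃ i, y ^ 2 = algebraMap F (AlgebraicClosure F) (c i)}

/-- The subfield `F² = {x² : x ∈ F}` of squares of a field of characteristic 2. -/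
noncomputable def sqSubfield : Subfield F := Subfield.closure (Set.range fun x : F => x ^ 2)

set_option synthInstance.maxHeartbeats 1000000 in
/-- The norm degree `[F²(cᵢ·cⱼ) : F²]` of a diagonal form `⟨c₁,…,c_s⟩`. -/
noncomputable def normDegree {s : ℕ} (c : Fin s → F) : ℕ :=
  Module.finrank (sqSubfield F)
    (IntermediateField.adjoin (sqSubfield F)
      (Set.range fun p : Fin s × Fin s => c p.1 * c p.2))

end Sqrt

/-- A ring is a division algebra if it is nontrivial and every nonzero element is a unit. -/
def IsDivisionAlgebra (T : Type) [Ring T] : Prop :=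
  (0 : T) ≠ 1 ∧ ∀ x : T, x ≠ 0 → IsUnit x

section CasselsPfister

open scoped Polynomial

theorem exists_represents_of_represents_mul_sq {B M : Type*} [Field B] [AddCommGroup M]
    [Module B[X] M] (Q : QuadraticForm B[X] M) (hQ : Q.Anisotropic)
    (hdiv : ∀ (v : M) (f : B[X]), 0 < f.natDegree →
      ∃ y : M, (Q (v - f • y)).natDegree ≤ 2 * (f.natDegree - 1))
    (t f : B[X]) (v : M) (hf : f ≠ 0) (h : Q v = t * f ^ 2) : ∃ v', Q v' = t := by
  induction hn : f.natDegree using Nat.strong_induction_on generalizing f v with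
  | _ n ih =>
    rcases Nat.eq_zero_or_pos n with h0 | hpos
    · obtain ⟨c, rfl⟩ := Polynomial.natDegree_eq_zero.1 (hn.trans h0)
      have hc : c ≠ 0 := by rintro rfl; simp at hf
      refine ⟨(Polynomial.C c⁻¹ : B[X]) • v, ?_⟩
      have hcc : (Polynomial.C c⁻¹ : B[X]) * Polynomial.C c = 1 := by
        rw [← Polynomial.C_mul, inv_mul_cancel₀ hc, Polynomial.C_1]
      rw [QuadraticMap.map_smul, h, smul_eq_mul]
      linear_combination (t * (Polynomial.C c⁻¹ * Polynomial.C c + 1)) * hcc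
    · obtain ⟨y, hy⟩ := hdiv v f (hn ▸ hpos)
      obtain ⟨r, hr⟩ : ∃ r, r = v - f • y := ⟨_, rfl⟩
      rw [← hr] at hy
      have hv : v = f • y + r := by rw [hr]; abel
      have hexp : t * f ^ 2 = f * f * Q y + Q r + f * QuadraticMap.polar Q y r := by
        rw [← h, hv, QuadraticMap.map_add (⇑Q) _ _, QuadraticMap.map_smul,
          QuadraticMap.polar_smul_left]
        simp
      by_cases hr0 : r = 0
      · refine ⟨y, ?_⟩
        subst hr0
        simp at hexp
        have : f * f * (t - Q y) = 0 := by linear_combination hexp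
        have := (mul_eq_zero.1 this).resolve_left (mul_ne_zero hf hf)
        exact (sub_eq_zero.1 this).symm
      · have hQr : Q r ≠ 0 := fun h' => hr0 (hQ r h')
        obtain ⟨g, hg⟩ : f ∣ Q r :=
          ⟨t * f - f * Q y - QuadraticMap.polar Q y r, by linear_combination -hexp⟩
        have hg0 : g ≠ 0 := by rintro rfl; simp [hg] at hQr
        have hdeg : g.natDegree < n := by
          rw [hg, Polynomial.natDegree_mul hf hg0] at hy
          omega
        have hP : QuadraticMap.polar Q y r = f * (t - Q y) - g :=
          mul_left_cancel₀ hf (by rw [hg] at hexp; linear_combination -hexp)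
        refine ih _ hdeg g (g • y + (Q y - t) • r) hg0 ?_ rfl
        rw [QuadraticMap.map_add (⇑Q) _ _, QuadraticMap.map_smul, QuadraticMap.map_smul,
          QuadraticMap.polar_smul_left, QuadraticMap.polar_smul_right, hP, hg]
        simp only [smul_eq_mul]
        ring

theorem exists_eq_X_pow_mul {B ι : Type*} [Field B] [Finite ι] (v : ι → B[X]) (hv : v ≠ 0) :
    ∃ (k : ℕ) (v' : ι → B[X]), (∀ i, v i = Polynomial.X ^ k * v' i) ∧
      ∃ i, (v' i).coeff 0 ≠ 0 := by
  classical
  cases nonempty_fintype ι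
  obtain ⟨i₀, hi₀⟩ := Function.ne_iff.1 hv
  by_contra! hcon
  have key : ∀ k, ∀ i, Polynomial.X ^ k ∣ v i := by
    intro k
    induction k with
    | zero => simp
    | succ k ih =>
      choose v' hv' using ih
      intro i
      obtain ⟨u, hu⟩ := Polynomial.X_dvd_iff.2 (hcon k v' hv' i)
      exact ⟨u, by rw [hv', hu]; ring⟩
  have := Polynomial.natDegree_le_of_dvd (key ((v i₀).natDegree + 1) i₀) hi₀
  simp at this

theorem toQuadraticMap'_apply {R : Type} [CommRing R] {n : ℕ} (M : Matrix (Fin n) (Fin n) R)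
    (v : Fin n → R) : M.toQuadraticMap' v = ∑ i, ∑ j, M i j * (v i * v j) := by
  simp only [Matrix.toQuadraticMap', Matrix.toQuadraticForm', LinearMap.BilinMap.toQuadraticMap_apply,
    Matrix.toLinearMap₂'_apply, smul_eq_mul]
  exact Finset.sum_congr rfl fun i _ => Finset.sum_congr rfl fun j _ => by ring

theorem binQF_apply {R : Type} [CommRing R] (a b : R) (v : Fin 2 → R) :
    binQF a b v = a * v 0 ^ 2 + v 0 * v 1 + b * v 1 ^ 2 := by
  rw [binQF, toQuadraticMap'_apply]
  simp [Fin.sum_univ_two]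
  ring

theorem diagQF_apply {R : Type} [CommRing R] {n : ℕ} (c v : Fin n → R) :
    diagQF c v = ∑ i, c i * v i ^ 2 := by
  simp [diagQF, QuadraticMap.weightedSumSquares_apply, pow_two]

theorem natDegree_binQF_add_diagQF_le {B : Type} [Field B] {n : ℕ} (a b : B) (g : Fin n → B)
    (u : Fin 2 → B[X]) (z : Fin n → B[X]) (N : ℕ) (hu : ∀ i, (u i).natDegree ≤ N)
    (hz : ∀ i, (z i).natDegree ≤ N) :
    (binQF (Polynomial.C a) (Polynomial.C b) u +
      diagQF (fun k => Polynomial.C (g k)) z).natDegree ≤ 2 * N := by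
  rw [binQF_apply, diagQF_apply]
  have hm : ∀ v w : B[X], v.natDegree ≤ N → w.natDegree ≤ N → (v * w).natDegree ≤ 2 * N :=
    fun v w h h' => Polynomial.natDegree_mul_le.trans (by omega)
  have hC : ∀ (c : B) (v : B[X]), v.natDegree ≤ N →
      (Polynomial.C c * v ^ 2).natDegree ≤ 2 * N := fun c v h =>
    (Polynomial.natDegree_C_mul_le _ _).trans (by rw [pow_two]; exact hm _ _ h h)
  refine Polynomial.natDegree_add_le_of_degree_le (Polynomial.natDegree_add_le_of_degree_le
    (Polynomial.natDegree_add_le_of_degree_le (hC _ _ (hu 0)) (hm _ _ (hu 0) (hu 1)))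
    (hC _ _ (hu 1))) ?_
  exact Polynomial.natDegree_sum_le_of_forall_le _ _ fun i _ => hC _ _ (hz i)

theorem coeff_binQF_add_diagQF {B : Type} [Field B] {n : ℕ} (a b : B) (g : Fin n → B)
    (u : Fin 2 → B[X]) (z : Fin n → B[X]) (N : ℕ) (hu : ∀ i, (u i).natDegree ≤ N)
    (hz : ∀ i, (z i).natDegree ≤ N) :
    (binQF (Polynomial.C a) (Polynomial.C b) u +
      diagQF (fun k => Polynomial.C (g k)) z).coeff (2 * N) =
      binQF a b (fun i => (u i).coeff N) + diagQF g (fun i => (z i).coeff N) := by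
  have hm : ∀ v w : B[X], v.natDegree ≤ N → w.natDegree ≤ N →
      (v * w).coeff (2 * N) = v.coeff N * w.coeff N := fun v w h h' => by
    rw [two_mul]; exact Polynomial.coeff_mul_add_eq_of_natDegree_le h h'
  simp only [binQF_apply, diagQF_apply, pow_two, Polynomial.coeff_add, Polynomial.coeff_C_mul,
    Polynomial.finsetSum_coeff]
  rw [hm _ _ (hu 0) (hu 0), hm _ _ (hu 0) (hu 1), hm _ _ (hu 1) (hu 1)]
  simp only [fun i => hm _ _ (hz i) (hz i)]

theorem anisotropic_polynomial {B : Type} [Field B] {n : ℕ} (a b : B) (g : Fin n → B)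
    (h : ((binQF a b).prod (diagQF g)).Anisotropic) :
    ((binQF (Polynomial.C a) (Polynomial.C b)).prod
      (diagQF (fun k => Polynomial.C (g k)))).Anisotropic := by
  rintro ⟨u, z⟩ huz
  by_contra hne
  obtain ⟨k, w, hw, i, hi⟩ := exists_eq_X_pow_mul (Sum.elim u z) (by
    intro h0
    apply hne
    ext i : 2
    · simpa using congrFun h0 (Sum.inl i)
    · simpa using congrFun h0 (Sum.inr i))
  have hu : u = (Polynomial.X ^ k : B[X]) • (fun i => w (Sum.inl i)) :=
    funext fun i => hw (Sum.inl i)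
  have hz : z = (Polynomial.X ^ k : B[X]) • (fun i => w (Sum.inr i)) :=
    funext fun i => hw (Sum.inr i)
  rw [QuadraticMap.prod_apply, hu, hz, QuadraticMap.map_smul, QuadraticMap.map_smul, ← smul_add,
    smul_eq_mul] at huz
  have h1 := (mul_eq_zero.1 huz).resolve_left (by simp)
  have h2 := congrArg (Polynomial.eval 0) h1
  have h3 := h (fun i => (w (Sum.inl i)).eval 0, fun i => (w (Sum.inr i)).eval 0) (by
    rw [QuadraticMap.prod_apply]
    simpa [binQF_apply, diagQF_apply, Polynomial.eval_finsetSum] using h2)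
  rw [Polynomial.coeff_zero_eq_eval_zero] at hi
  rcases i with i | i
  · exact hi (congrFun (congrArg Prod.fst h3) i)
  · exact hi (congrFun (congrArg Prod.snd h3) i)

theorem exists_of_represents_add_X_sq_mul {B : Type} [Field B] [CharP B 2] {n : ℕ}
    (a b t₁ t₂ : B) (g : Fin n → B) (haniso : ((binQF a b).prod (diagQF g)).Anisotropic)
    (u : Fin 2 → B[X]) (z : Fin n → B[X]) (f : B[X]) (hf : f ≠ 0)
    (h : binQF (Polynomial.C a) (Polynomial.C b) u + diagQF (fun k => Polynomial.C (g k)) z =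
      (Polynomial.C t₁ + Polynomial.X ^ 2 * Polynomial.C t₂) * f ^ 2) :
    ∃ (u₀ u₁ : Fin 2 → B) (z₀ z₁ : Fin n → B), binQF a b u₀ + diagQF g z₀ = t₁ ∧
      binQF a b u₁ + diagQF g z₁ = t₂ ∧ u₀ 0 * u₁ 1 + u₁ 0 * u₀ 1 = 0 := by
  classical
  obtain ⟨⟨U, Z⟩, hUZ⟩ := exists_represents_of_represents_mul_sq
    ((binQF (Polynomial.C a) (Polynomial.C b)).prod (diagQF (fun k => Polynomial.C (g k))))
    (anisotropic_polynomial a b g haniso) (by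
      rintro ⟨v, w⟩ f hf
      have hmod : ∀ p : B[X], (p - f * (p / f)).natDegree ≤ f.natDegree - 1 := fun p => by
        rw [← EuclideanDomain.mod_eq_sub_mul_div]
        have := Polynomial.natDegree_mod_lt p hf.ne'
        omega
      exact ⟨(fun i => v i / f, fun i => w i / f), natDegree_binQF_add_diagQF_le a b g _ _ _
        (fun i => hmod _) (fun i => hmod _)⟩) _ f (u, z) hf h
  rw [QuadraticMap.prod_apply] at hUZ
  dsimp only at hUZ
  have hN : ∃ N, (∀ i, (U i).natDegree ≤ N) ∧ ∀ i, (Z i).natDegree ≤ N := by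
    refine ⟨Finset.univ.sup (fun i => (U i).natDegree) +
      Finset.univ.sup (fun i => (Z i).natDegree), fun i => ?_, fun i => ?_⟩
    · exact (Finset.le_sup (f := fun i => (U i).natDegree) (Finset.mem_univ i)).trans
        (Nat.le_add_right _ _)
    · exact (Finset.le_sup (f := fun i => (Z i).natDegree) (Finset.mem_univ i)).trans
        (Nat.le_add_left _ _)
  have hdeg : (∀ i, (U i).natDegree ≤ 1) ∧ ∀ i, (Z i).natDegree ≤ 1 := by
    obtain ⟨hU, hZ⟩ := Nat.find_spec hN
    have hmin := fun m => Nat.find_min hN (m := m)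
    generalize Nat.find hN = N at hU hZ hmin
    rcases le_or_gt N 1 with h1 | h1
    · exact ⟨fun i => (hU i).trans h1, fun i => (hZ i).trans h1⟩
    · exfalso
      have hc := coeff_binQF_add_diagQF a b g U Z N hU hZ
      rw [hUZ, Polynomial.coeff_add, Polynomial.coeff_C_of_ne_zero (by omega),
        Polynomial.coeff_mul_C, Polynomial.coeff_X_pow, if_neg (by omega)] at hc
      have h0 := haniso (_, _) (by rw [QuadraticMap.prod_apply, ← hc]; simp)
      have key : ∀ p : B[X], p.natDegree ≤ N → p.coeff N = 0 → p.natDegree ≤ N - 1 := by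
        intro p hp hp0
        rw [Polynomial.natDegree_le_iff_coeff_eq_zero] at hp ⊢
        intro m hm
        rcases (show m = N ∨ N < m by omega) with rfl | h
        exacts [hp0, hp m h]
      exact hmin (N - 1) (by omega)
        ⟨fun i => key _ (hU i) (congrFun (congrArg Prod.fst h0) i),
          fun i => key _ (hZ i) (congrFun (congrArg Prod.snd h0) i)⟩
  have h2 := coeff_binQF_add_diagQF a b g U Z 1 hdeg.1 hdeg.2
  refine ⟨fun i => (U i).coeff 0, fun i => (U i).coeff 1, fun i => (Z i).coeff 0,
    fun i => (Z i).coeff 1, ?_, ?_, ?_⟩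
  · have := congrArg (Polynomial.eval 0) hUZ
    simpa [binQF_apply, diagQF_apply, Polynomial.eval_finsetSum,
      Polynomial.coeff_zero_eq_eval_zero] using this
  · rw [← h2, hUZ]
    simp
  · have h3 := congrArg (fun p => Polynomial.coeff p 1) hUZ
    have hsq : ∀ p : B[X], (p ^ 2).coeff 1 = 0 := fun p => by
      rw [pow_two, Polynomial.mul_coeff_one]
      linear_combination (p.coeff 0 * p.coeff 1) * (CharTwo.two_eq_zero (R := B))
    simp only [binQF_apply, diagQF_apply, Polynomial.coeff_add,
      Polynomial.finsetSum_coeff, hsq, Polynomial.mul_coeff_one] at h3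
    simp [Polynomial.coeff_C] at h3
    linear_combination h3

end CasselsPfister

section Transfer

open scoped Polynomial

/-- The form `[a,b] ⊥ ⟨1,p,q⟩`. -/
def quinary {R : Type} [CommRing R] (a b p q : R) (x : Fin 5 → R) : R :=
  a * x 0 ^ 2 + x 0 * x 1 + b * x 1 ^ 2 + x 2 ^ 2 + p * x 3 ^ 2 + q * x 4 ^ 2

/-- The form `[a,b] ⊥ ⟨1,p,q,pq⟩`. -/
def senary {R : Type} [CommRing R] (a b p q : R) (x : Fin 6 → R) : R :=
  a * x 0 ^ 2 + x 0 * x 1 + b * x 1 ^ 2 + x 2 ^ 2 + p * x 3 ^ 2 + q * x 4 ^ 2 +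
    p * q * x 5 ^ 2

/-- The senary form `[a,b] ⊥ ⟨1,p,q,pq⟩` is anisotropic. -/
def SenaryAnisotropic {R : Type} [CommRing R] (a b p q : R) : Prop :=
  ∀ x : Fin 6 → R, senary a b p q x = 0 → x = 0

/-- The polynomial `∑ eᵢ Xᵢ²` of the diagonal form `⟨e₁,…,e_s⟩`. -/
noncomputable def diagPoly {R : Type} [CommRing R] {s : ℕ} (e : Fin s → R) :
    MvPolynomial (Fin s) R :=
  ∑ i, C (e i) * X i ^ 2

/-- The quinary form `[a,b] ⊥ ⟨1,p,q⟩` has a nontrivial zero modulo `∑ eᵢ Xᵢ²`. -/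
def IsotropicMod {R : Type} [CommRing R] {s : ℕ} (e : Fin s → R) (a b p q : R) : Prop :=
  ∃ f : Fin 5 → MvPolynomial (Fin s) R, diagPoly e ∣ quinary (C a) (C b) (C p) (C q) f ∧
    ∃ i, ¬ diagPoly e ∣ f i

theorem map_quinary {R S : Type} [CommRing R] [CommRing S] (f : R →+* S) (a b p q : R)
    (x : Fin 5 → R) :
    f (quinary a b p q x) = quinary (f a) (f b) (f p) (f q) (fun i => f (x i)) := by
  simp [quinary]

theorem map_senary {R S : Type} [CommRing R] [CommRing S] (f : R →+* S) (a b p q : R)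
    (x : Fin 6 → R) :
    f (senary a b p q x) = senary (f a) (f b) (f p) (f q) (fun i => f (x i)) := by
  simp [senary]

theorem quinary_smul {R : Type} [CommRing R] (a b p q c : R) (x : Fin 5 → R) :
    quinary a b p q (fun i => c * x i) = c ^ 2 * quinary a b p q x := by
  simp only [quinary]; ring

theorem senary_smul {R : Type} [CommRing R] (a b p q c : R) (x : Fin 6 → R) :
    senary a b p q (fun i => c * x i) = c ^ 2 * senary a b p q x := by
  simp only [senary]; ring

theorem SenaryAnisotropic.quinary {R : Type} [CommRing R] {a b p q : R}
    (h : SenaryAnisotropic a b p q) (x : Fin 5 → R) (hx : quinary a b p q x = 0) : x = 0 := by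
  have := h ![x 0, x 1, x 2, x 3, x 4, 0] (by
    simp only [_root_.quinary] at hx
    simpa [senary] using hx)
  ext i
  fin_cases i
  exacts [congrFun this 0, congrFun this 1, congrFun this 2, congrFun this 3, congrFun this 4]

/-- A nonzero vector over the fraction field of `F[X]` is proportional to a polynomial vector
whose value at `0` is nonzero. -/
theorem exists_mul_eq_algebraMap {F G ι : Type} [Field F] [Field G] [Algebra F[X] G]
    [IsFractionRing F[X] G] [Finite ι] (v : ι → G) (hv : v ≠ 0) :
    ∃ (c : G) (v' : ι → F[X]), c ≠ 0 ∧ (∀ i, c * v i = algebraMap F[X] G (v' i)) ∧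
      ∃ i, (v' i).coeff 0 ≠ 0 := by
  classical
  cases nonempty_fintype ι
  obtain ⟨d, hd⟩ := IsLocalization.exist_integer_multiples (nonZeroDivisors F[X]) Finset.univ v
  choose w hw using fun i => hd i (Finset.mem_univ i)
  have hinj := IsFractionRing.injective F[X] G
  have hd0 : algebraMap F[X] G d ≠ 0 := by
    rw [Ne, map_eq_zero_iff _ hinj]
    exact nonZeroDivisors.coe_ne_zero d
  have hw0 : w ≠ 0 := by
    rintro rfl
    refine hv (funext fun i => ?_)
    have := hw i
    rw [Pi.zero_apply, map_zero, Algebra.smul_def] at this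
    exact (mul_eq_zero.1 this.symm).resolve_left hd0
  obtain ⟨k, w', hk, i, hi⟩ := exists_eq_X_pow_mul w hw0
  have hX : algebraMap F[X] G (Polynomial.X ^ k) ≠ 0 := by
    rw [Ne, map_eq_zero_iff _ hinj]; simp
  refine ⟨algebraMap F[X] G d / algebraMap F[X] G (Polynomial.X ^ k), w',
    div_ne_zero hd0 hX, fun j => ?_, i, hi⟩
  have := hw j
  rw [hk, map_mul, Algebra.smul_def] at this
  rw [div_mul_eq_mul_div, ← this, mul_div_cancel_left₀ _ hX]

theorem SenaryAnisotropic.ratFunc {F : Type} [Field F] {a b p q : F}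
    (h : SenaryAnisotropic a b p q) :
    SenaryAnisotropic (RatFunc.C a) (RatFunc.C b) (RatFunc.C p) (RatFunc.C q) := by
  intro x hx
  by_contra hx0
  obtain ⟨c, v, hc, hv, i, hi⟩ := exists_mul_eq_algebraMap (F := F) x hx0
  have h1 := senary_smul (RatFunc.C a) (RatFunc.C b) (RatFunc.C p) (RatFunc.C q) c x
  rw [hx, mul_zero] at h1
  simp only [hv, ← RatFunc.algebraMap_C] at h1
  rw [← map_senary, map_eq_zero_iff _ (IsFractionRing.injective F[X] (RatFunc F))] at h1
  have h2 := congrArg (Polynomial.evalRingHom 0) h1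
  rw [map_senary, map_zero] at h2
  simp only [Polynomial.coe_evalRingHom, Polynomial.eval_C] at h2
  exact hi (by rw [Polynomial.coeff_zero_eq_eval_zero]; exact congrFun (h _ h2) i)

theorem anisotropic_diagQF_ratFunc {F : Type} [Field F] {s : ℕ} {e : Fin s → F}
    (h : (diagQF e).Anisotropic) : (diagQF fun i => RatFunc.C (e i)).Anisotropic := by
  intro x hx
  by_contra hx0
  obtain ⟨c, v, hc, hv, i, hi⟩ := exists_mul_eq_algebraMap (F := F) x hx0
  have h1 : diagQF (fun i => RatFunc.C (e i)) (c • x) = 0 := by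
    rw [QuadraticMap.map_smul, hx, smul_zero]
  rw [diagQF_apply] at h1
  simp only [Pi.smul_apply, smul_eq_mul, hv, ← RatFunc.algebraMap_C, ← map_mul, ← map_pow,
    ← map_sum] at h1
  rw [map_eq_zero_iff _ (IsFractionRing.injective F[X] (RatFunc F))] at h1
  have h2 := congrArg (Polynomial.eval 0) h1
  simp only [Polynomial.eval_finsetSum, Polynomial.eval_mul, Polynomial.eval_C,
    Polynomial.eval_pow, Polynomial.eval_zero] at h2
  exact hi (by
    rw [Polynomial.coeff_zero_eq_eval_zero]
    exact congrFun (h (fun i => (v i).eval 0) (by rw [diagQF_apply, h2])) i)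

/-- Divisibility of polynomials descends along field extensions. -/
theorem MvPolynomial.dvd_of_map_dvd_map {σ F G : Type} [Field F] [Field G] (κ : F →+* G)
    (P f : MvPolynomial σ F) (h : map κ P ∣ map κ f) : P ∣ f := by
  classical
  let := κ.toAlgebra
  obtain ⟨r, hr⟩ := (Algebra.linearMap F G).exists_leftInverse_of_injective
    (LinearMap.ker_eq_bot.2 κ.injective)
  have hr' : ∀ x : F, r (κ x) = x := fun x => LinearMap.congr_fun hr x
  have hrm : ∀ (x : F) (y : G), r (κ x * y) = x * r y := fun x y => r.map_smul x y
  obtain ⟨g, hg⟩ := h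
  refine ⟨∑ m ∈ g.support, monomial m (r (coeff m g)), ?_⟩
  have hc : ∀ m, coeff m (∑ m ∈ g.support, monomial m (r (coeff m g))) = r (coeff m g) := by
    intro m
    simp only [coeff_sum, coeff_monomial]
    rw [Finset.sum_ite_eq']
    split_ifs with hm
    · rfl
    · rw [notMem_support_iff.1 hm, map_zero]
  ext m
  rw [coeff_mul, ← hr' (coeff m f), ← coeff_map, hg, coeff_mul, map_sum]
  refine Finset.sum_congr rfl fun x _ => ?_
  rw [hc, coeff_map, hrm]

theorem map_diagPoly {R S : Type} [CommRing R] [CommRing S] (f : R →+* S) {s : ℕ}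
    (e : Fin s → R) : map f (diagPoly e) = diagPoly (fun i => f (e i)) := by
  simp [diagPoly]

theorem IsotropicMod.map {F G : Type} [Field F] [Field G] (κ : F →+* G) {s : ℕ} {e : Fin s → F}
    {a b p q : F} (h : IsotropicMod e a b p q) :
    IsotropicMod (fun i => κ (e i)) (κ a) (κ b) (κ p) (κ q) := by
  obtain ⟨f, hf, i, hi⟩ := h
  refine ⟨fun i => MvPolynomial.map κ (f i), ?_, i, fun h => hi ?_⟩
  · rw [← map_diagPoly]
    have := map_dvd (MvPolynomial.map κ) hf
    rwa [map_quinary, map_C, map_C, map_C, map_C] at this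
  · rw [← map_diagPoly] at h
    exact MvPolynomial.dvd_of_map_dvd_map κ _ _ h

instance RatFunc.charP_two {F : Type} [Field F] [CharP F 2] : CharP (RatFunc F) 2 :=
  charP_of_injective_ringHom (RatFunc.C (K := F)).injective 2

end Transfer

section LeadingVector

open scoped MonomialOrder

variable {σ : Type} (m : MonomialOrder σ) {G : Type} [Field G]

theorem exists_degree_le_coeff_ne_zero {ι : Type} [Finite ι] (w : ι → MvPolynomial σ G)
    (hw : w ≠ 0) :
    ∃ D, (∀ i, m.degree (w i) ≼[m] D) ∧ (fun i => coeff D (w i)) ≠ 0 := by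
  classical
  cases nonempty_fintype ι
  obtain ⟨i₀, hi₀⟩ := Function.ne_iff.1 hw
  obtain ⟨i, hi, hmax⟩ := Finset.exists_max_image (Finset.univ.filter fun i => w i ≠ 0)
    (fun i => m.toSyn (m.degree (w i))) ⟨i₀, by simpa using hi₀⟩
  simp only [Finset.mem_filter, Finset.mem_univ, true_and] at hi hmax
  refine ⟨m.degree (w i), fun j => ?_, fun h => ?_⟩
  · by_cases hj : w j = 0
    · rw [hj, m.degree_zero, map_zero]; exact m.zero_le _
    · exact hmax j hj
  · exact m.coeff_degree_ne_zero_iff.2 hi (congrFun h i)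

variable {m}

theorem MonomialOrder.degree_add_le_of_le {f g : MvPolynomial σ G} {A : σ →₀ ℕ}
    (hf : m.degree f ≼[m] A) (hg : m.degree g ≼[m] A) : m.degree (f + g) ≼[m] A :=
  m.degree_add_le.trans (sup_le hf hg)

theorem MonomialOrder.degree_mul_le_of_le {f g : MvPolynomial σ G} {A B : σ →₀ ℕ}
    (hf : m.degree f ≼[m] A) (hg : m.degree g ≼[m] B) : m.degree (f * g) ≼[m] A + B :=
  m.degree_mul_le.trans (by rw [map_add, map_add]; exact add_le_add hf hg)

theorem MonomialOrder.degree_C_mul_le_of_le {f : MvPolynomial σ G} {A : σ →₀ ℕ} (c : G)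
    (hf : m.degree f ≼[m] A) : m.degree (C c * f) ≼[m] A := by
  have := MonomialOrder.degree_mul_le_of_le (m.degree_C c ▸ le_refl _ : m.degree (C c) ≼[m] 0) hf
  rwa [zero_add] at this

variable {D : σ →₀ ℕ} {w : Fin 5 → MvPolynomial σ G}

theorem degree_quinary_le (a b p q : G) (hw : ∀ i, m.degree (w i) ≼[m] D) :
    m.degree (quinary (C a) (C b) (C p) (C q) w) ≼[m] D + D := by
  have h2 : ∀ i j, m.degree (w i * w j) ≼[m] D + D := fun i j =>
    MonomialOrder.degree_mul_le_of_le (hw i) (hw j)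
  simp only [quinary, pow_two]
  have hC : ∀ (c : G) i j, m.degree (C c * (w i * w j)) ≼[m] D + D := fun c i j =>
    MonomialOrder.degree_C_mul_le_of_le c (h2 i j)
  have hadd : ∀ f g : MvPolynomial σ G, m.degree f ≼[m] D + D → m.degree g ≼[m] D + D →
      m.degree (f + g) ≼[m] D + D := fun _ _ => MonomialOrder.degree_add_le_of_le
  exact hadd _ _ (hadd _ _ (hadd _ _ (hadd _ _ (hadd _ _ (hC a 0 0) (h2 0 1)) (hC b 1 1))
    (h2 2 2)) (hC p 3 3)) (hC q 4 4)

theorem coeff_quinary (a b p q : G) (hw : ∀ i, m.degree (w i) ≼[m] D) :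
    coeff (D + D) (quinary (C a) (C b) (C p) (C q) w) =
      quinary a b p q (fun i => coeff D (w i)) := by
  have h2 : ∀ i j, coeff (D + D) (w i * w j) = coeff D (w i) * coeff D (w j) := fun i j =>
    MonomialOrder.coeff_mul_of_add_of_degree_le (hw i) (hw j)
  simp only [quinary, pow_two, coeff_add, coeff_C_mul, h2]

variable {n : ℕ}

theorem degree_diagPoly_le (d : Fin (n + 1) → G) :
    MonomialOrder.lex.degree (diagPoly d) ≼[MonomialOrder.lex] Finsupp.single 0 2 := by
  rw [diagPoly]
  refine MonomialOrder.degree_sum_le.trans (Finset.sup_le fun i _ => ?_)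
  apply MonomialOrder.degree_C_mul_le_of_le
  rw [X_pow_eq_monomial]
  refine (MonomialOrder.degree_monomial_le _).trans ?_
  rw [MonomialOrder.lex_le_iff]
  rcases eq_or_ne i 0 with rfl | hi
  · rfl
  · refine le_of_lt ⟨0, ?_, ?_⟩
    · intro j hj; exact absurd hj (by simp)
    · simp [hi]

theorem coeff_diagPoly (d : Fin (n + 1) → G) :
    coeff (Finsupp.single 0 2) (diagPoly d) = d 0 := by
  simp only [diagPoly, coeff_sum, coeff_C_mul, X_pow_eq_monomial, coeff_monomial]
  rw [Finset.sum_eq_single 0]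
  · simp
  · intro i _ hi
    rw [if_neg, mul_zero]
    intro h
    have := congrFun (congrArg DFunLike.coe h) 0
    simp [hi] at this
  · simp

theorem exists_of_quinary_eq_diagPoly_mul {a b p q : G} (hq : ∀ x, quinary a b p q x = 0 → x = 0)
    (d : Fin (n + 1) → G) (hd : d 0 ≠ 0) (u v : Fin 5 → MvPolynomial (Fin (n + 1)) G)
    (hne : u ≠ 0 ∨ v ≠ 0)
    (h : quinary (C a) (C b) (C p) (C q) u = diagPoly d * quinary (C a) (C b) (C p) (C q) v)
    (hb : u 0 * v 1 + u 1 * v 0 = 0) :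
    ∃ U V : Fin 5 → G, V ≠ 0 ∧ quinary a b p q U = d 0 * quinary a b p q V ∧
      U 0 * V 1 + U 1 * V 0 = 0 := by
  have key : ∀ w : Fin 5 → MvPolynomial (Fin (n + 1)) G, w ≠ 0 →
      quinary (C a) (C b) (C p) (C q) w ≠ 0 := by
    intro w hw h0
    obtain ⟨D, hD, hD0⟩ := exists_degree_le_coeff_ne_zero MonomialOrder.lex w hw
    refine hD0 (hq _ ?_)
    rw [← coeff_quinary a b p q hD, h0, coeff_zero]
  have h0 : quinary (C a) (C b) (C p) (C q) (0 : Fin 5 → MvPolynomial (Fin (n + 1)) G) = 0 := by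
    simp [quinary]
  have hd0 : diagPoly d ≠ 0 := fun h => hd (by rw [← coeff_diagPoly d, h, coeff_zero])
  have hu : u ≠ 0 := by
    rintro rfl
    refine mul_ne_zero hd0 (key v (hne.resolve_left (by simp))) ?_
    rw [← h, h0]
  have hv : v ≠ 0 := by
    rintro rfl
    exact key u hu (by rw [h, h0, mul_zero])
  obtain ⟨A, hA, hA0⟩ := exists_degree_le_coeff_ne_zero MonomialOrder.lex u hu
  obtain ⟨B, hB, hB0⟩ := exists_degree_le_coeff_ne_zero MonomialOrder.lex v hv
  have hcA := coeff_quinary a b p q hA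
  have hcB := MonomialOrder.coeff_mul_of_add_of_degree_le (degree_diagPoly_le d)
    (degree_quinary_le a b p q hB)
  rw [coeff_quinary a b p q hB, coeff_diagPoly, ← h] at hcB
  have hdeg := MonomialOrder.degree_mul_le_of_le (degree_diagPoly_le d)
    (degree_quinary_le a b p q hB)
  rw [← h] at hdeg
  have hAB : A + A = Finsupp.single 0 2 + (B + B) := by
    apply MonomialOrder.lex.toSyn.injective
    apply le_antisymm
    · refine (MonomialOrder.le_degree ?_).trans hdeg
      rw [mem_support_iff, hcA]
      exact fun h => hA0 (hq _ h)
    · refine (MonomialOrder.le_degree ?_).trans (degree_quinary_le a b p q hA)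
      rw [mem_support_iff, hcB]
      exact mul_ne_zero hd fun h => hB0 (hq _ h)
  refine ⟨fun i => coeff A (u i), _, hB0, ?_, ?_⟩
  · rw [← hcA, ← hcB, hAB]
  · have h01 := MonomialOrder.coeff_mul_of_add_of_degree_le (hA 0) (hB 1)
    have h10 := MonomialOrder.coeff_mul_of_add_of_degree_le (hA 1) (hB 0)
    rw [← h01, ← h10, ← coeff_add, hb, coeff_zero]

end LeadingVector

section Specialization

open scoped Polynomial

theorem exists_of_X_sq_add_C_dvd_quinary {R : Type} [CommRing R] [CharP R 2] {a b p q t : R}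
    {f : Fin 5 → R[X]} (h : Polynomial.X ^ 2 + Polynomial.C t ∣
      quinary (Polynomial.C a) (Polynomial.C b) (Polynomial.C p) (Polynomial.C q) f)
    (hne : ∃ i, ¬ Polynomial.X ^ 2 + Polynomial.C t ∣ f i) :
    ∃ u v : Fin 5 → R, (u ≠ 0 ∨ v ≠ 0) ∧ quinary a b p q u = t * quinary a b p q v ∧
      u 0 * v 1 + u 1 * v 0 = 0 := by
  obtain ⟨i, hi⟩ := hne
  have hnt : Nontrivial R := ⟨0, 1, fun h01 => hi (by
    have : Subsingleton R := subsingleton_of_zero_eq_one h01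
    exact ⟨0, Subsingleton.elim _ _⟩)⟩
  have hmon : (Polynomial.X ^ 2 + Polynomial.C t : R[X]).Monic :=
    Polynomial.monic_X_pow_add_C t two_ne_zero
  have hdegm : (Polynomial.X ^ 2 + Polynomial.C t : R[X]).degree = 2 :=
    Polynomial.degree_X_pow_add_C two_pos t
  have hrep : ∀ j, ∃ u v : R, Polynomial.X ^ 2 + Polynomial.C t ∣
      f j - (Polynomial.C u + Polynomial.X * Polynomial.C v) := by
    intro j
    have hlt : (f j %ₘ (Polynomial.X ^ 2 + Polynomial.C t)).natDegree ≤ 1 := by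
      have := Polynomial.natDegree_modByMonic_lt (f j) hmon (by
        intro h1; rw [h1, Polynomial.degree_one] at hdegm; exact absurd hdegm (by decide))
      rw [Polynomial.natDegree_X_pow_add_C] at this
      omega
    obtain ⟨v, u, huv⟩ := Polynomial.exists_eq_X_add_C_of_natDegree_le_one hlt
    refine ⟨u, v, f j /ₘ (Polynomial.X ^ 2 + Polynomial.C t), ?_⟩
    have := Polynomial.modByMonic_add_div (f j) (Polynomial.X ^ 2 + Polynomial.C t)
    linear_combination -this + huv
  choose u v huv using hrep
  refine ⟨u, v, ?_, ?_⟩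
  · by_contra! hcon
    have := huv i
    rw [hcon.1, hcon.2] at this
    simp at this
    exact hi this
  · let π := Ideal.Quotient.mk (Ideal.span {(Polynomial.X ^ 2 + Polynomial.C t : R[X])})
    have hπ : ∀ g, π g = 0 ↔ Polynomial.X ^ 2 + Polynomial.C t ∣ g := fun g => by
      rw [Ideal.Quotient.eq_zero_iff_mem, Ideal.mem_span_singleton]
    have h1 := (hπ _).2 h
    have h2 : ∀ j, π (f j) = π (Polynomial.C (u j) + Polynomial.X * Polynomial.C (v j)) :=
      fun j => by rw [← sub_eq_zero, ← map_sub, hπ]; exact huv j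
    rw [map_quinary] at h1
    simp only [h2] at h1
    rw [← map_quinary, hπ] at h1
    have h20 : (2 : R[X]) = 0 := CharTwo.two_eq_zero
    have hexp : quinary (Polynomial.C a) (Polynomial.C b) (Polynomial.C p) (Polynomial.C q)
        (fun j => Polynomial.C (u j) + Polynomial.X * Polynomial.C (v j)) =
        (Polynomial.X ^ 2 + Polynomial.C t) * Polynomial.C (quinary a b p q v) +
        (Polynomial.C (u 0 * v 1 + u 1 * v 0) * Polynomial.X +
          Polynomial.C (quinary a b p q u - t * quinary a b p q v)) := by
      simp only [quinary, Polynomial.C_add, Polynomial.C_mul, Polynomial.C_sub, Polynomial.C_pow]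
      linear_combination (Polynomial.X *
        (Polynomial.C a * Polynomial.C (u 0) * Polynomial.C (v 0) +
        Polynomial.C b * Polynomial.C (u 1) * Polynomial.C (v 1) +
        Polynomial.C (u 2) * Polynomial.C (v 2) +
        Polynomial.C p * Polynomial.C (u 3) * Polynomial.C (v 3) +
        Polynomial.C q * Polynomial.C (u 4) * Polynomial.C (v 4))) * h20
    rw [hexp, dvd_add_right (dvd_mul_right _ _)] at h1
    have h3 := not_not.1 fun h0 => hmon.not_dvd_of_degree_lt h0 (by
      rw [hdegm]; exact (Polynomial.degree_linear_le).trans_lt (by decide)) h1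
    constructor
    · have := congrArg (fun g => Polynomial.coeff g 0) h3
      simp at this
      linear_combination this
    · have := congrArg (fun g => Polynomial.coeff g 1) h3
      simpa [Polynomial.coeff_C] using this

theorem IsotropicMod.exists_quinary_eq {G : Type} [Field G] [CharP G 2] {n : ℕ}
    {e : Fin (n + 2) → G} {a b p q : G} (h : IsotropicMod e a b p q)
    (hq : ∀ x, quinary a b p q x = 0 → x = 0) (h0 : e 0 ≠ 0) (h1 : e 1 ≠ 0) :
    ∃ U V : Fin 5 → G, V ≠ 0 ∧ quinary a b p q U = (e 1 / e 0) * quinary a b p q V ∧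
      U 0 * V 1 + U 1 * V 0 = 0 := by
  obtain ⟨f, hf, i, hi⟩ := h
  have hP : finSuccEquiv G (n + 1) (diagPoly e) = Polynomial.C (C (e 0)) *
      (Polynomial.X ^ 2 + Polynomial.C (diagPoly fun i : Fin (n + 1) => e i.succ / e 0)) := by
    rw [diagPoly, Fin.sum_univ_succ, map_add, map_mul, map_pow, finSuccEquiv_X_zero, map_sum,
      diagPoly, map_sum, mul_add, Finset.mul_sum]
    have hC : ∀ c, finSuccEquiv G (n + 1) (C c) = Polynomial.C (C c) := fun c => by
      rw [← algebraMap_eq, AlgEquiv.commutes]; rfl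
    rw [hC]
    congr 1
    refine Finset.sum_congr rfl fun j _ => ?_
    rw [map_mul, map_pow, finSuccEquiv_X_succ, hC, ← Polynomial.C_pow, ← Polynomial.C_mul,
      ← Polynomial.C_mul, ← mul_assoc, ← C_mul, mul_div_cancel₀ _ h0]
  have hC : ∀ c, finSuccEquiv G (n + 1) (C c) = Polynomial.C (C c) := fun c => by
    rw [← algebraMap_eq, AlgEquiv.commutes]; rfl
  have hu : IsUnit (Polynomial.C (C (e 0)) : (MvPolynomial (Fin (n + 1)) G)[X]) :=
    ((Ne.isUnit h0).map C).map Polynomial.C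
  have hdvd : ∀ g, diagPoly e ∣ g ↔
      Polynomial.X ^ 2 + Polynomial.C (diagPoly fun i : Fin (n + 1) => e i.succ / e 0) ∣
        finSuccEquiv G (n + 1) g := fun g => by
    rw [← map_dvd_iff (finSuccEquiv G (n + 1)), hP, hu.mul_left_dvd]
  rw [hdvd] at hf hi
  have hf' := map_quinary (finSuccEquiv G (n + 1)).toRingEquiv.toRingHom (C a) (C b) (C p) (C q) f
  simp only [RingEquiv.toRingHom_eq_coe, RingHom.coe_coe,
    AlgEquiv.coe_ringEquiv, hC] at hf'
  rw [hf'] at hf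
  obtain ⟨u, v, hne, huv, hb⟩ := exists_of_X_sq_add_C_dvd_quinary hf ⟨i, hi⟩
  exact exists_of_quinary_eq_diagPoly_mul hq _ (div_ne_zero h1 h0) u v hne huv hb

theorem exists_linearEquiv_single {G : Type} [Field G] {n : ℕ} (x y : Fin (n + 2) → G)
    (h : LinearIndependent G ![x, y]) :
    ∃ A : (Fin (n + 2) → G) ≃ₗ[G] (Fin (n + 2) → G),
      A (Pi.single 0 1) = x ∧ A (Pi.single 1 1) = y := by
  classical
  obtain ⟨b, hb⟩ : ∃ b : Module.Basis (Fin 2 ⊕ Module.Basis.sumExtendIndex h) G (Fin (n + 2) → G),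
      b = Module.Basis.sumExtend h := ⟨_, rfl⟩
  have hb' : ∀ i, b (Sum.inl i) = ![x, y] i := fun i => by
    rw [hb, Module.Basis.sumExtend]
    simp
    rfl
  have : Finite (Fin 2 ⊕ Module.Basis.sumExtendIndex h) := Module.Finite.finite_basis b
  have hfin : Finite (Module.Basis.sumExtendIndex h) :=
    Finite.of_injective (β := Fin 2 ⊕ Module.Basis.sumExtendIndex h) Sum.inr Sum.inr_injective
  cases nonempty_fintype (Module.Basis.sumExtendIndex h)
  have hcard : Fintype.card (Module.Basis.sumExtendIndex h) = n := by
    have h1 := Module.finrank_eq_card_basis b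
    rw [Module.finrank_fin_fun, Fintype.card_sum,
      Fintype.card_fin] at h1
    omega
  let ε : Fin 2 ⊕ Module.Basis.sumExtendIndex h ≃ Fin (n + 2) :=
    ((Equiv.refl _).sumCongr (Fintype.equivFinOfCardEq hcard)).trans
      (finSumFinEquiv.trans (finCongr (add_comm 2 n)))
  have h0 : ε.symm 0 = Sum.inl 0 := by
    rw [Equiv.symm_apply_eq]; ext; simp [ε]
  have h1 : ε.symm 1 = Sum.inl 1 := by
    rw [Equiv.symm_apply_eq]; ext; simp [ε]
  refine ⟨(Pi.basisFun G (Fin (n + 2))).equiv b ε.symm, ?_, ?_⟩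
  · rw [← Pi.basisFun_apply, Module.Basis.equiv_apply, h0]
    rw [hb']; rfl
  · rw [← Pi.basisFun_apply, Module.Basis.equiv_apply, h1]
    rw [hb']; rfl

theorem IsotropicMod.linearEquiv {G : Type} [Field G] [CharP G 2] {s : ℕ}
    {e : Fin s → G} {a b p q : G} (h : IsotropicMod e a b p q)
    (A : (Fin s → G) ≃ₗ[G] (Fin s → G)) :
    IsotropicMod (fun i => diagQF e (A (Pi.single i 1))) a b p q := by
  let θ (B : (Fin s → G) ≃ₗ[G] (Fin s → G)) : MvPolynomial (Fin s) G →ₐ[G] MvPolynomial (Fin s) G :=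
    aeval fun j => ∑ i, C (B (Pi.single i 1) j) * X i
  have hθ : ∀ g, θ A.symm (θ A g) = g := by
    intro g
    rw [← AlgHom.comp_apply]
    refine (DFunLike.congr_fun (?_ : _ = AlgHom.id G _) g :)
    ext j : 1
    have hk : ∀ k, A.symm (Pi.single k 1) = ∑ i, A.symm (Pi.single k 1) i • Pi.single i 1 :=
      fun k => (pi_eq_sum_univ' _).trans (by
        refine Finset.sum_congr rfl fun i _ => ?_
        congr 1)
    have hk' : ∀ k, (Pi.single k 1 : Fin s → G) j =
        ∑ i, A.symm (Pi.single k 1) i * A (Pi.single i 1) j := fun k => by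
      have := congrArg A (hk k)
      rw [LinearEquiv.apply_symm_apply, map_sum] at this
      refine (congrFun this j).trans ?_
      simp only [Finset.sum_apply, map_smul, Pi.smul_apply, smul_eq_mul]
    simp only [θ, AlgHom.comp_apply, aeval_X, map_sum, map_mul, AlgHom.id_apply, algHom_C,
      algebraMap_eq, Finset.mul_sum]
    rw [Finset.sum_comm]
    have : ∀ k, ∑ i, (C (A (Pi.single i 1) j) * (C (A.symm (Pi.single k 1) i) * X k) :
        MvPolynomial (Fin s) G) = C ((Pi.single k 1 : Fin s → G) j) * X k := fun k => by
      rw [hk', map_sum, Finset.sum_mul]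
      exact Finset.sum_congr rfl fun i _ => by rw [C_mul]; ring
    simp only [this]
    rw [Finset.sum_eq_single j]
    · simp
    · intro k _ hk
      simp [hk.symm]
    · simp
  have hP : θ A (diagPoly e) = diagPoly (fun i => diagQF e (A (Pi.single i 1))) := by
    simp only [diagPoly, diagQF_apply, θ, map_sum, map_mul, map_pow, algHom_C, algebraMap_eq,
      aeval_X, CharTwo.sum_sq, Finset.mul_sum, Finset.sum_mul]
    rw [Finset.sum_comm]
    exact Finset.sum_congr rfl fun i _ => Finset.sum_congr rfl fun j _ => by ring
  obtain ⟨f, hf, i, hi⟩ := h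
  refine ⟨fun j => θ A (f j), ?_, i, fun h => hi ?_⟩
  · have := map_dvd (θ A) hf
    have h2 := map_quinary (θ A).toRingHom (C a) (C b) (C p) (C q) f
    simp only [AlgHom.toRingHom_eq_coe, RingHom.coe_coe, algHom_C, algebraMap_eq] at h2
    rwa [h2, hP] at this
  · have := map_dvd (θ A.symm) h
    rwa [← hP, hθ, hθ] at this

/-- The form `[a,b] ⊥ ⟨1,p,q⟩ ⊥ τ⟨1,p,q⟩`. -/
def octonary {R : Type} [CommRing R] (a b p q τ : R) (x : Fin 8 → R) : R :=
  a * x 0 ^ 2 + x 0 * x 1 + b * x 1 ^ 2 + (x 2 ^ 2 + p * x 3 ^ 2 + q * x 4 ^ 2) +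
    τ * (x 5 ^ 2 + p * x 6 ^ 2 + q * x 7 ^ 2)

theorem exists_octonary_eq_zero_of_quinary {G : Type} [Field G] [CharP G 2] {a b p q τ : G}
    (hτ : τ ≠ 0) {U V : Fin 5 → G} (hV : V ≠ 0)
    (h : quinary a b p q U = τ * quinary a b p q V) (hb : U 0 * V 1 + U 1 * V 0 = 0) :
    ∃ v, v ≠ 0 ∧ octonary a b p q τ v = 0 := by
  have h2 : (2 : G) = 0 := CharTwo.two_eq_zero
  simp only [quinary] at h
  by_cases hU0 : U 0 = 0 ∧ U 1 = 0
  · obtain ⟨h0, h1⟩ := hU0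
    refine ⟨![τ * V 0, τ * V 1, τ * V 2, τ * V 3, τ * V 4, U 2, U 3, U 4], fun h0' => hV ?_, ?_⟩
    · ext i
      fin_cases i
      · simpa [hτ] using congrFun h0' 0
      · simpa [hτ] using congrFun h0' 1
      · simpa [hτ] using congrFun h0' 2
      · simpa [hτ] using congrFun h0' 3
      · simpa [hτ] using congrFun h0' 4
    · simp [octonary]
      rw [h0, h1] at h
      linear_combination -τ * h + τ * (U 2 ^ 2 + p * U 3 ^ 2 + q * U 4 ^ 2) * h2
  · obtain ⟨l, hl0, hl1⟩ : ∃ l, V 0 = l * U 0 ∧ V 1 = l * U 1 := by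
      by_cases h0 : U 0 = 0
      · have h1 : U 1 ≠ 0 := fun h1 => hU0 ⟨h0, h1⟩
        refine ⟨V 1 / U 1, ?_, by field_simp⟩
        rw [h0, zero_mul, zero_add] at hb
        rw [h0, (mul_eq_zero.1 hb).resolve_left h1, mul_zero]
      · refine ⟨V 0 / U 0, by field_simp, ?_⟩
        field_simp
        linear_combination hb - U 1 * V 0 * h2
    rw [hl0, hl1] at h
    by_cases hc : 1 + τ * l ^ 2 = 0
    · refine ⟨![0, 0, 1, 0, 0, l, 0, 0], fun h0' => ?_, ?_⟩
      · simpa using congrFun h0' 2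
      · simp [octonary]
        exact hc
    · refine ⟨![(1 + τ * l ^ 2) * U 0, (1 + τ * l ^ 2) * U 1, U 2 + τ * l * V 2,
        U 3 + τ * l * V 3, U 4 + τ * l * V 4, V 2 + l * U 2, V 3 + l * U 3, V 4 + l * U 4],
        fun h0' => hU0 ⟨?_, ?_⟩, ?_⟩
      · simpa [hc] using congrFun h0' 0
      · simpa [hc] using congrFun h0' 1
      · simp [octonary]
        linear_combination (1 + τ * l ^ 2) * h + (τ * (1 + τ * l ^ 2) *
          (l ^ 2 * (a * U 0 ^ 2 + U 0 * U 1 + b * U 1 ^ 2) + V 2 ^ 2 + p * V 3 ^ 2 + q * V 4 ^ 2) +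
          2 * τ * l * (U 2 * V 2 + p * U 3 * V 3 + q * U 4 * V 4)) * h2

/-- If `F(ψ)` makes `[a,b] ⊥ ⟨1,p,q⟩` isotropic and `τ` is a quotient of two values of `ψ`, then
`[a,b] ⊥ ⟨1,p,q⟩ ⊥ τ⟨1,p,q⟩` is isotropic. -/
theorem IsotropicMod.exists_octonary_eq_zero {G : Type} [Field G] [CharP G 2] {s : ℕ}
    {e : Fin s → G} {a b p q : G} (h : IsotropicMod e a b p q)
    (hq : ∀ x, quinary a b p q x = 0 → x = 0) (he : (diagQF e).Anisotropic) (τ : G)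
    (x x' : Fin s → G) (hne : x ≠ 0 ∨ x' ≠ 0) (hx : diagQF e x = τ * diagQF e x') :
    ∃ v, v ≠ 0 ∧ octonary a b p q τ v = 0 := by
  have h2 : (2 : G) = 0 := CharTwo.two_eq_zero
  by_cases hli : LinearIndependent G ![x', x]
  · have hs : ∃ n, s = n + 2 := by
      have := hli.fintype_card_le_finrank
      rw [Module.finrank_fin_fun, Fintype.card_fin] at this
      exact ⟨s - 2, by omega⟩
    obtain ⟨n, rfl⟩ := hs
    obtain ⟨A, h0, h1⟩ := exists_linearEquiv_single x' x hli
    have hx0 : x ≠ 0 := hli.ne_zero 1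
    have hx0' : x' ≠ 0 := hli.ne_zero 0
    have hv : diagQF e x ≠ 0 := fun h => hx0 (he _ h)
    have hv' : diagQF e x' ≠ 0 := fun h => hx0' (he _ h)
    obtain ⟨U, V, hV, hUV, hb⟩ := (h.linearEquiv A).exists_quinary_eq hq
      (by rwa [h0]) (by rwa [h1])
    rw [h0, h1, hx, mul_div_cancel_right₀ _ hv'] at hUV
    exact exists_octonary_eq_zero_of_quinary (fun h => hv (by rw [hx, h, zero_mul])) hV hUV hb
  · have hx0' : x' ≠ 0 := by
      rintro rfl
      rw [QuadraticMap.map_zero, mul_zero] at hx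
      exact (hne.resolve_right (by simp)) (he _ hx)
    have hv' : diagQF e x' ≠ 0 := fun h => hx0' (he _ h)
    rw [LinearIndependent.pair_iff' hx0'] at hli
    push Not at hli
    obtain ⟨l, rfl⟩ := hli
    rw [QuadraticMap.map_smul, smul_eq_mul] at hx
    have hτ := mul_right_cancel₀ hv' hx
    refine ⟨![0, 0, l, 0, 0, 1, 0, 0], fun h0 => ?_, ?_⟩
    · simpa using congrFun h0 5
    · simp [octonary]
      linear_combination hτ + τ * h2

end Specialization

section Subfields

open scoped Polynomial

variable {F : Type} [Field F] [CharP F 2]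

/-- The subfield `F²(p) = F² + pF²`. -/
def sqAdjoin (p : F) : Subfield F where
  carrier := {x | ∃ α β : F, x = α ^ 2 + p * β ^ 2}
  mul_mem' := by
    rintro _ _ ⟨α, β, rfl⟩ ⟨γ, δ, rfl⟩
    exact ⟨α * γ + p * β * δ, α * δ + β * γ, by
      simp only [CharTwo.add_sq]; ring⟩
  one_mem' := ⟨1, 0, by ring⟩
  add_mem' := by
    rintro _ _ ⟨α, β, rfl⟩ ⟨γ, δ, rfl⟩
    exact ⟨α + γ, β + δ, by simp only [CharTwo.add_sq]; ring⟩
  zero_mem' := ⟨0, 0, by ring⟩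
  neg_mem' := by
    rintro _ ⟨α, β, rfl⟩
    exact ⟨α, β, CharTwo.neg_eq _⟩
  inv_mem' := by
    rintro _ ⟨α, β, rfl⟩
    rcases eq_or_ne (α ^ 2 + p * β ^ 2) 0 with h | h
    · exact ⟨0, 0, by rw [h]; simp⟩
    · exact ⟨α * (α ^ 2 + p * β ^ 2)⁻¹, β * (α ^ 2 + p * β ^ 2)⁻¹, by field_simp⟩

/-- The subfield `F²(p,q) = F² + pF² + qF² + pqF²`. -/
def sqAdjoin₂ (p q : F) : Subfield F where
  carrier := {x | ∃ α β γ δ : F, x = α ^ 2 + p * β ^ 2 + q * γ ^ 2 + p * q * δ ^ 2}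
  mul_mem' := by
    rintro _ _ ⟨α, β, γ, δ, rfl⟩ ⟨α', β', γ', δ', rfl⟩
    exact ⟨α * α' + p * β * β' + q * γ * γ' + p * q * δ * δ',
      α * β' + β * α' + q * γ * δ' + q * δ * γ', α * γ' + γ * α' + p * β * δ' + p * δ * β',
      α * δ' + δ * α' + β * γ' + γ * β', by simp only [CharTwo.add_sq]; ring⟩
  one_mem' := ⟨1, 0, 0, 0, by ring⟩
  add_mem' := by
    rintro _ _ ⟨α, β, γ, δ, rfl⟩ ⟨α', β', γ', δ', rfl⟩
    exact ⟨α + α', β + β', γ + γ', δ + δ', by simp only [CharTwo.add_sq]; ring⟩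
  zero_mem' := ⟨0, 0, 0, 0, by ring⟩
  neg_mem' := by
    rintro _ ⟨α, β, γ, δ, rfl⟩
    exact ⟨α, β, γ, δ, CharTwo.neg_eq _⟩
  inv_mem' := by
    rintro _ ⟨α, β, γ, δ, rfl⟩
    generalize hx : α ^ 2 + p * β ^ 2 + q * γ ^ 2 + p * q * δ ^ 2 = x
    rcases eq_or_ne x 0 with h | h
    · exact ⟨0, 0, 0, 0, by rw [h]; simp⟩
    · exact ⟨α * x⁻¹, β * x⁻¹, γ * x⁻¹, δ * x⁻¹, by
        calc x⁻¹ = x * x⁻¹ ^ 2 := by field_simp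
          _ = _ := by rw [← hx]; ring⟩

theorem sq_mem_sqAdjoin (p x : F) : x ^ 2 ∈ sqAdjoin p := ⟨x, 0, by ring⟩

theorem self_mem_sqAdjoin (p : F) : p ∈ sqAdjoin p := ⟨0, 1, by ring⟩

theorem sqAdjoin_le (p q : F) : sqAdjoin p ≤ sqAdjoin₂ p q := by
  rintro _ ⟨α, β, rfl⟩
  exact ⟨α, β, 0, 0, by ring⟩

theorem sq_mem_sqAdjoin₂ (p q x : F) : x ^ 2 ∈ sqAdjoin₂ p q := sqAdjoin_le p q ⟨x, 0, by ring⟩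

theorem left_mem_sqAdjoin₂ (p q : F) : p ∈ sqAdjoin₂ p q := ⟨0, 1, 0, 0, by ring⟩

theorem right_mem_sqAdjoin₂ (p q : F) : q ∈ sqAdjoin₂ p q := ⟨0, 0, 1, 0, by ring⟩

/-- The Frobenius homomorphism onto squares, with values in a subfield containing them. -/
def sqHom (B : Subfield F) (h : ∀ x : F, x ^ 2 ∈ B) : F →+* B :=
  (frobenius F 2).codRestrict B h

theorem coe_sqHom (B : Subfield F) (h : ∀ x : F, x ^ 2 ∈ B) (x : F) :
    (sqHom B h x : F) = x ^ 2 := rfl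

variable {a b p q : F}

theorem SenaryAnisotropic.eq_zero_of_mem (h : SenaryAnisotropic a b p q) {x y z : F}
    (hx : x ∈ sqAdjoin₂ p q) (hy : y ∈ sqAdjoin₂ p q) (hz : z ∈ sqAdjoin₂ p q)
    (h0 : a ^ 2 * x ^ 2 + x * y + b ^ 2 * y ^ 2 + z ^ 2 = 0) : x = 0 ∧ y = 0 ∧ z = 0 := by
  have h2 : (2 : F) = 0 := CharTwo.two_eq_zero
  have hx0 : x = 0 := by
    by_contra hx0
    obtain ⟨α, β, γ, δ, hαβ⟩ := div_mem hz hx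
    have hz' : z = x * (z / x) := by field_simp
    have hy' : y = x * (y / x) := by field_simp
    have h1 : y / x = (a + b * (y / x) + z / x) ^ 2 := by
      rw [CharTwo.add_sq, CharTwo.add_sq]
      field_simp
      linear_combination -h0 + (x * y) * h2
    have h3 := h ![1, a + b * (y / x) + z / x, α, β, γ, δ] (by
      simp only [senary]
      simp
      rw [← h1]
      linear_combination -hαβ + (a + b * (y / x) + z / x) * h2)
    simpa using congrFun h3 0
  subst hx0
  have h1 : b * y + z = 0 := by
    rw [← sq_eq_zero_iff, CharTwo.add_sq]
    linear_combination h0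
  have hy0 : y = 0 := by
    by_contra hy0
    obtain ⟨α, β, γ, δ, hαβ⟩ := div_mem hz hy
    have h3 := h ![0, 1, α, β, γ, δ] (by
      simp only [senary]
      simp
      have : b = -(z / y) := by field_simp; linear_combination h1
      linear_combination this - hαβ)
    simpa using congrFun h3 1
  subst hy0
  exact ⟨rfl, rfl, by simpa using h1⟩

omit [CharP F 2] in
theorem SenaryAnisotropic.eq_zero_of_quaternary (h : SenaryAnisotropic a b p q) {α β γ δ : F}
    (h0 : α ^ 2 + p * β ^ 2 + q * γ ^ 2 + p * q * δ ^ 2 = 0) :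
    α = 0 ∧ β = 0 ∧ γ = 0 ∧ δ = 0 := by
  have h3 := h ![0, 0, α, β, γ, δ] (by
    simp only [senary]
    simpa using h0)
  exact ⟨congrFun h3 2, congrFun h3 3, congrFun h3 4, congrFun h3 5⟩

theorem SenaryAnisotropic.notMem_sqAdjoin (h : SenaryAnisotropic a b p q) : q ∉ sqAdjoin p := by
  rintro ⟨α, β, hq⟩
  have := h.eq_zero_of_quaternary (α := α) (β := β) (γ := 1) (δ := 0) (by
    linear_combination hq + (α ^ 2 + p * β ^ 2) * CharTwo.two_eq_zero (R := F))
  exact one_ne_zero this.2.2.1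

theorem SenaryAnisotropic.eq_zero_of_mem_sqAdjoin (h : SenaryAnisotropic a b p q) {x y z w : F}
    (hx : x ∈ sqAdjoin p) (hy : y ∈ sqAdjoin p) (hz : z ∈ sqAdjoin p) (hw : w ∈ sqAdjoin p)
    (h0 : a ^ 2 * x ^ 2 + x * y + b ^ 2 * y ^ 2 + z ^ 2 + q ^ 2 * w ^ 2 = 0) :
    x = 0 ∧ y = 0 ∧ z = 0 ∧ w = 0 := by
  have hle := sqAdjoin_le p q
  obtain ⟨h1, h2, h3⟩ := h.eq_zero_of_mem (hle hx) (hle hy)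
    (add_mem (hle hz) (mul_mem (right_mem_sqAdjoin₂ p q) (hle hw)))
    (by rw [CharTwo.add_sq]; linear_combination h0)
  have hw0 : w = 0 := by
    by_contra hw0
    refine h.notMem_sqAdjoin ?_
    have : q = -(z / w) := by field_simp; linear_combination h3
    rw [this]
    exact neg_mem (div_mem hz hw)
  exact ⟨h1, h2, by simpa [hw0] using h3, hw0⟩

theorem exists_eq_smul_of_cross_eq_zero {B : Type} [Field B] [CharP B 2] {u v : Fin 2 → B}
    (hu : u ≠ 0) (h : u 0 * v 1 + v 0 * u 1 = 0) : ∃ l : B, v = l • u := by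
  have h2 : (2 : B) = 0 := CharTwo.two_eq_zero
  by_cases h0 : u 0 = 0
  · have h1 : u 1 ≠ 0 := fun h1 => hu (by ext i; fin_cases i <;> assumption)
    refine ⟨v 1 / u 1, ?_⟩
    rw [h0, zero_mul, zero_add] at h
    ext i; fin_cases i
    · simpa [h0] using (mul_eq_zero.1 h).resolve_right h1
    · simp [h1]
  · refine ⟨v 0 / u 0, ?_⟩
    ext i; fin_cases i
    · simp [h0]
    · simp
      field_simp
      linear_combination h - v 0 * u 1 * h2

theorem sq_injective_of_charTwo {x y : F} (h : x ^ 2 = y ^ 2) : x = y := by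
  rw [← sub_eq_zero, ← sq_eq_zero_iff, sub_sq]
  linear_combination h + (y ^ 2 - x * y) * CharTwo.two_eq_zero (R := F)

theorem coe_diagQF_sqHom {B : Subfield F} (h : ∀ x : F, x ^ 2 ∈ B) {n : ℕ} (c : Fin n → F)
    (z : Fin n → B) : (diagQF (fun k => sqHom B h (c k)) z : F) = (∑ k, c k * z k) ^ 2 := by
  rw [diagQF_apply, CharTwo.sum_sq]
  push_cast
  exact Finset.sum_congr rfl fun k _ => by rw [coe_sqHom]; ring

theorem coe_binQF_sqHom {B : Subfield F} (h : ∀ x : F, x ^ 2 ∈ B) (a b : F) (u : Fin 2 → B) :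
    (binQF (sqHom B h a) (sqHom B h b) u : F) =
      a ^ 2 * u 0 ^ 2 + u 0 * u 1 + b ^ 2 * u 1 ^ 2 := by
  rw [binQF_apply]
  push_cast
  simp only [coe_sqHom]

theorem eq_sum_or_exists_add_mul_eq_sum {B : Subfield F} (hB : ∀ x : F, x ^ 2 ∈ B) {n : ℕ}
    (c : Fin n → F) (haniso : ((binQF (sqHom B hB a) (sqHom B hB b)).prod
      (diagQF fun k => sqHom B hB (c k))).Anisotropic) (d₁ d₂ : F)
    (u : Fin 2 → B[X]) (z : Fin n → B[X]) (f : B[X]) (hf : f ≠ 0)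
    (h : binQF (Polynomial.C (sqHom B hB a)) (Polynomial.C (sqHom B hB b)) u +
      diagQF (fun k => Polynomial.C (sqHom B hB (c k))) z =
      (Polynomial.C (sqHom B hB d₁) + Polynomial.X ^ 2 * Polynomial.C (sqHom B hB d₂)) * f ^ 2) :
    (∃ z : Fin n → B, d₁ = ∑ k, c k * z k) ∨
      ∃ (l : B) (z : Fin n → B), d₂ + l * d₁ = ∑ k, c k * z k := by
  obtain ⟨u₀, u₁, z₀, z₁, h₀, h₁, hc⟩ := exists_of_represents_add_X_sq_mul _ _ _ _ _ haniso u z f hf h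
  by_cases hu : u₀ = 0
  · left
    refine ⟨z₀, sq_injective_of_charTwo ?_⟩
    rw [← coe_diagQF_sqHom hB, ← coe_sqHom B hB, ← h₀, hu, QuadraticMap.map_zero, zero_add]
  · right
    obtain ⟨l, rfl⟩ := exists_eq_smul_of_cross_eq_zero hu hc
    refine ⟨l, z₁ + l • z₀, sq_injective_of_charTwo ?_⟩
    have hs : ∑ k, c k * ((z₁ + l • z₀) k : B) =
        ∑ k, c k * (z₁ k : F) + l * ∑ k, c k * (z₀ k : F) := by
      rw [Finset.mul_sum, ← Finset.sum_add_distrib]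
      refine Finset.sum_congr rfl fun k _ => ?_
      simp
      ring
    rw [hs, CharTwo.add_sq, CharTwo.add_sq, mul_pow, mul_pow, ← coe_diagQF_sqHom hB,
      ← coe_diagQF_sqHom hB, ← coe_sqHom B hB d₂, ← coe_sqHom B hB d₁, ← h₀, ← h₁,
      QuadraticMap.map_smul]
    simp
    linear_combination (l ^ 2 * binQF (sqHom B hB a) (sqHom B hB b) u₀ : F) *
      CharTwo.two_eq_zero (R := F)

end Subfields

section Contradiction

open scoped Polynomial

theorem map_octonary {R S : Type} [CommRing R] [CommRing S] (f : R →+* S) (a b p q τ : R)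
    (x : Fin 8 → R) :
    f (octonary a b p q τ x) = octonary (f a) (f b) (f p) (f q) (f τ) (fun i => f (x i)) := by
  simp [octonary]

theorem octonary_smul {R : Type} [CommRing R] (a b p q τ c : R) (x : Fin 8 → R) :
    octonary a b p q τ (fun i => c * x i) = c ^ 2 * octonary a b p q τ x := by
  simp only [octonary]; ring

/-- The form `[a,b] ⊥ ⟨1,p,q,pq⟩ ⊥ t⟨1,p⟩`. -/
def octonary' {R : Type} [CommRing R] (a b p q t : R) (x : Fin 8 → R) : R :=
  a * x 0 ^ 2 + x 0 * x 1 + b * x 1 ^ 2 +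
    (x 2 ^ 2 + p * x 3 ^ 2 + q * x 4 ^ 2 + p * q * x 5 ^ 2) + t * (x 6 ^ 2 + p * x 7 ^ 2)

theorem map_octonary' {R S : Type} [CommRing R] [CommRing S] (f : R →+* S) (a b p q τ : R)
    (x : Fin 8 → R) :
    f (octonary' a b p q τ x) = octonary' (f a) (f b) (f p) (f q) (f τ) (fun i => f (x i)) := by
  simp [octonary']

theorem octonary'_smul {R : Type} [CommRing R] (a b p q τ c : R) (x : Fin 8 → R) :
    octonary' a b p q τ (fun i => c * x i) = c ^ 2 * octonary' a b p q τ x := by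
  simp only [octonary']; ring

section

variable {F : Type} [Field F] [CharP F 2] {a b p q : F}

theorem SenaryAnisotropic.eq_zero_of_map_sqHom (h : SenaryAnisotropic a b p q) {B : Subfield F}
    (hB : ∀ x : F, x ^ 2 ∈ B) (pB qB : B) (hp : (pB : F) = p) (hq : (qB : F) = q)
    {x y z : F[X]} (h0 : x.map (sqHom B hB) + Polynomial.C pB * y.map (sqHom B hB) +
      Polynomial.C qB * z.map (sqHom B hB) = 0) : x = 0 ∧ y = 0 ∧ z = 0 := by
  have key : ∀ n, x.coeff n = 0 ∧ y.coeff n = 0 ∧ z.coeff n = 0 := fun n => by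
    have h1 := congrArg (fun f : B[X] => ((f.coeff n : B) : F)) h0
    simp only [Polynomial.coeff_add, Polynomial.coeff_C_mul, Polynomial.coeff_map,
      Polynomial.coeff_zero] at h1
    push_cast at h1
    simp only [coe_sqHom, hp, hq] at h1
    obtain ⟨h2, h3, h4, -⟩ := h.eq_zero_of_quaternary (δ := 0) (by
      simpa using h1)
    exact ⟨h2, h3, h4⟩
  refine ⟨?_, ?_, ?_⟩ <;> ext n
  exacts [(key n).1, (key n).2.1, (key n).2.2]

theorem SenaryAnisotropic.anisotropic_sqAdjoin₂ (h : SenaryAnisotropic a b p q) :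
    ((binQF (sqHom _ (sq_mem_sqAdjoin₂ p q) a) (sqHom _ (sq_mem_sqAdjoin₂ p q) b)).prod
      (diagQF fun k => sqHom _ (sq_mem_sqAdjoin₂ p q) (![(1 : F)] k))).Anisotropic := by
  rintro ⟨u, z⟩ h0
  have h1 := congrArg (Subtype.val) h0
  rw [QuadraticMap.prod_apply] at h1
  push_cast at h1
  rw [coe_binQF_sqHom, coe_diagQF_sqHom] at h1
  obtain ⟨h2, h3, h4⟩ := h.eq_zero_of_mem (u 0).2 (u 1).2 (z 0).2 (by simpa using h1)
  rw [ZeroMemClass.coe_eq_zero] at h2 h3 h4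
  refine Prod.ext ?_ ?_ <;> ext i <;> fin_cases i <;> simpa

theorem SenaryAnisotropic.anisotropic_sqAdjoin (h : SenaryAnisotropic a b p q) :
    ((binQF (sqHom _ (sq_mem_sqAdjoin p) a) (sqHom _ (sq_mem_sqAdjoin p) b)).prod
      (diagQF fun k => sqHom _ (sq_mem_sqAdjoin p) (![1, q] k))).Anisotropic := by
  rintro ⟨u, z⟩ h0
  have h1 := congrArg (Subtype.val) h0
  rw [QuadraticMap.prod_apply] at h1
  push_cast at h1
  rw [coe_binQF_sqHom, coe_diagQF_sqHom] at h1
  obtain ⟨h2, h3, h4, h5⟩ := h.eq_zero_of_mem_sqAdjoin (u 0).2 (u 1).2 (z 0).2 (z 1).2 (by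
    simp only [Fin.sum_univ_two] at h1
    simp [CharTwo.add_sq] at h1
    linear_combination h1)
  rw [ZeroMemClass.coe_eq_zero] at h2 h3 h4 h5
  refine Prod.ext ?_ ?_ <;> ext i <;> fin_cases i <;> simpa

theorem SenaryAnisotropic.mem_or_of_octonary (h : SenaryAnisotropic a b p q) {d₁ d₂ : F}
    {w : Fin 8 → F[X]} (hw : w ≠ 0)
    (h0 : octonary (Polynomial.C a) (Polynomial.C b) (Polynomial.C p) (Polynomial.C q)
      (Polynomial.C d₁ + Polynomial.X ^ 2 * Polynomial.C d₂) w = 0) :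
    d₁ ∈ sqAdjoin₂ p q ∨ ∃ l ∈ sqAdjoin₂ p q, d₂ + l * d₁ ∈ sqAdjoin₂ p q := by
  have hB := sq_mem_sqAdjoin₂ p q
  set σ := sqHom _ hB with hσ
  let P : sqAdjoin₂ p q := ⟨p, left_mem_sqAdjoin₂ p q⟩
  let Q : sqAdjoin₂ p q := ⟨q, right_mem_sqAdjoin₂ p q⟩
  have hP : σ p = P ^ 2 := rfl
  have hQ : σ q = Q ^ 2 := rfl
  have h1 := congrArg (Polynomial.mapRingHom σ) h0
  rw [map_octonary, map_zero] at h1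
  simp only [map_add, map_mul, map_pow, Polynomial.coe_mapRingHom, Polynomial.map_C,
    Polynomial.map_X, hP, hQ] at h1
  have h2 : (2 : (sqAdjoin₂ p q)[X]) = 0 := CharTwo.two_eq_zero
  let W := fun k => (w k).map σ
  let f := W 5 + Polynomial.C P * W 6 + Polynomial.C Q * W 7
  let z := W 2 + Polynomial.C P * W 3 + Polynomial.C Q * W 4
  have h3 : binQF (Polynomial.C (σ a)) (Polynomial.C (σ b)) ![W 0, W 1] +
      diagQF (fun k => Polynomial.C (σ (![(1 : F)] k))) ![z] =
      (Polynomial.C (σ d₁) + Polynomial.X ^ 2 * Polynomial.C (σ d₂)) * f ^ 2 := by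
    rw [binQF_apply, diagQF_apply]
    simp [W, f, z, CharTwo.add_sq]
    simp only [octonary] at h1
    linear_combination h1 - ((Polynomial.C (σ d₁) + Polynomial.X ^ 2 * Polynomial.C (σ d₂)) *
      (W 5 ^ 2 + Polynomial.C P ^ 2 * W 6 ^ 2 + Polynomial.C Q ^ 2 * W 7 ^ 2)) * h2
  have hf : f ≠ 0 := by
    intro hf
    rw [hf, zero_pow two_ne_zero, mul_zero] at h3
    have h4 := anisotropic_polynomial _ _ _ h.anisotropic_sqAdjoin₂ (![W 0, W 1], ![z]) h3
    rw [Prod.mk_eq_zero] at h4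
    have h5 : W 0 = 0 := congrFun h4.1 0
    have h6 : W 1 = 0 := congrFun h4.1 1
    have h7 := h.eq_zero_of_map_sqHom hB P Q rfl rfl (congrFun h4.2 0)
    have h8 := h.eq_zero_of_map_sqHom hB P Q rfl rfl hf
    rw [Polynomial.map_eq_zero] at h5 h6
    refine hw (funext fun i => ?_)
    fin_cases i
    exacts [h5, h6, h7.1, h7.2.1, h7.2.2, h8.1, h8.2.1, h8.2.2]
  rcases eq_sum_or_exists_add_mul_eq_sum hB ![(1 : F)] h.anisotropic_sqAdjoin₂ d₁ d₂ _ _ f hf h3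
    with ⟨z, hz⟩ | ⟨l, z, hz⟩
  · left
    rw [hz]
    simp
  · right
    refine ⟨l, l.2, ?_⟩
    rw [hz]
    simp

theorem SenaryAnisotropic.mem_of_octonary' (h : SenaryAnisotropic a b p q) {d : F}
    {w : Fin 8 → F[X]} (hw : w ≠ 0)
    (h0 : octonary' (Polynomial.C a) (Polynomial.C b) (Polynomial.C p) (Polynomial.C q)
      (Polynomial.C d + Polynomial.X ^ 2 * Polynomial.C (d * q)) w = 0) :
    d ∈ sqAdjoin₂ p q := by
  have hB := sq_mem_sqAdjoin p
  set σ := sqHom _ hB with hσ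
  let P : sqAdjoin p := ⟨p, self_mem_sqAdjoin p⟩
  have hP : σ p = P ^ 2 := rfl
  have h1 := congrArg (Polynomial.mapRingHom σ) h0
  rw [map_octonary', map_zero] at h1
  simp only [map_add, map_mul, map_pow, Polynomial.coe_mapRingHom, Polynomial.map_C,
    Polynomial.map_X, hP] at h1
  have h2 : (2 : (sqAdjoin p)[X]) = 0 := CharTwo.two_eq_zero
  let W := fun k => (w k).map σ
  let f := W 6 + Polynomial.C P * W 7
  let z₀ := W 2 + Polynomial.C P * W 3
  let z₁ := W 4 + Polynomial.C P * W 5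
  have h3 : binQF (Polynomial.C (σ a)) (Polynomial.C (σ b)) ![W 0, W 1] +
      diagQF (fun k => Polynomial.C (σ (![1, q] k))) ![z₀, z₁] =
      (Polynomial.C (σ d) + Polynomial.X ^ 2 * Polynomial.C (σ (d * q))) * f ^ 2 := by
    rw [binQF_apply, diagQF_apply]
    simp [W, f, z₀, z₁, CharTwo.add_sq]
    simp only [octonary'] at h1
    linear_combination h1 - ((Polynomial.C (σ d) + Polynomial.X ^ 2 *
      (Polynomial.C (σ d) * Polynomial.C (σ q))) *
      (W 6 ^ 2 + Polynomial.C P ^ 2 * W 7 ^ 2)) * h2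
  have key : ∀ {x y : F[X]}, x.map σ + Polynomial.C P * y.map σ = 0 → x = 0 ∧ y = 0 := by
    intro x y hxy
    have hle : sqAdjoin p ≤ sqAdjoin₂ p q := sqAdjoin_le p q
    have := h.eq_zero_of_map_sqHom (x := x) (y := y) (z := 0) (sq_mem_sqAdjoin₂ p q)
      (Subfield.inclusion hle P) ⟨q, right_mem_sqAdjoin₂ p q⟩ rfl rfl (by
        have h5 := congrArg (Polynomial.map (Subfield.inclusion hle)) hxy
        simp only [Polynomial.map_add, Polynomial.map_mul, Polynomial.map_map, Polynomial.map_C,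
          Polynomial.map_zero, mul_zero, add_zero] at h5 ⊢
        exact h5)
    exact ⟨this.1, this.2.1⟩
  have hf : f ≠ 0 := by
    intro hf
    rw [hf, zero_pow two_ne_zero, mul_zero] at h3
    have h4 := anisotropic_polynomial _ _ _ h.anisotropic_sqAdjoin (![W 0, W 1], ![z₀, z₁]) h3
    rw [Prod.mk_eq_zero] at h4
    have h5 : W 0 = 0 := congrFun h4.1 0
    have h6 : W 1 = 0 := congrFun h4.1 1
    have h7 := key (congrFun h4.2 0)
    have h8 := key (congrFun h4.2 1)
    have h9 := key hf
    rw [Polynomial.map_eq_zero] at h5 h6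
    refine hw (funext fun i => ?_)
    fin_cases i
    exacts [h5, h6, h7.1, h7.2, h8.1, h8.2, h9.1, h9.2]
  have hmem : ∀ z : Fin 2 → sqAdjoin p, ∑ k, ![1, q] k * (z k : F) ∈ sqAdjoin₂ p q := fun z => by
    simp only [Fin.sum_univ_two]
    simp
    exact add_mem (sqAdjoin_le p q (z 0).2)
      (mul_mem (right_mem_sqAdjoin₂ p q) (sqAdjoin_le p q (z 1).2))
  rcases eq_sum_or_exists_add_mul_eq_sum hB ![1, q] h.anisotropic_sqAdjoin d (d * q) _ _ f hf h3
    with ⟨z, hz⟩ | ⟨l, z, hz⟩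
  · rw [hz]
    exact hmem z
  · have hl : q + l ≠ 0 := fun h0 => h.notMem_sqAdjoin (by
      rw [eq_neg_of_add_eq_zero_left h0]
      exact neg_mem l.2)
    have : d = (∑ k, ![1, q] k * (z k : F)) / (q + l) := by
      rw [← hz]
      field_simp
    rw [this]
    exact div_mem (hmem z) (add_mem (right_mem_sqAdjoin₂ p q) (sqAdjoin_le p q l.2))

/-- A diagonal form whose coefficients lie in the `F²`-span of fewer elements is isotropic. -/
theorem exists_sum_mul_sq_eq_zero {ι κ : Type} [Fintype ι] [Fintype κ]
    (hcard : Fintype.card κ < Fintype.card ι) (ω : κ → F) (c : ι → F) (γ : ι → κ → F)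
    (h : ∀ j, c j = ∑ k, ω k * γ j k ^ 2) : ∃ x : ι → F, x ≠ 0 ∧ ∑ j, c j * x j ^ 2 = 0 := by
  let T : (ι → F) →ₗ[F] (κ → F) := (Matrix.of γ).vecMulLinear
  have hT : LinearMap.ker T ≠ ⊥ := LinearMap.ker_ne_bot_of_finrank_lt (by simpa)
  obtain ⟨x, hx, hx0⟩ := (Submodule.ne_bot_iff _).1 hT
  refine ⟨x, hx0, ?_⟩
  have h1 : ∀ k, ∑ j, x j * γ j k = 0 := fun k => congrFun (LinearMap.mem_ker.1 hx) k
  calc ∑ j, c j * x j ^ 2 = ∑ k, ω k * (∑ j, x j * γ j k) ^ 2 := by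
        simp only [CharTwo.sum_sq, h, Finset.sum_mul, Finset.mul_sum]
        rw [Finset.sum_comm]
        exact Finset.sum_congr rfl fun k _ => Finset.sum_congr rfl fun j _ => by ring
    _ = 0 := by simp [h1]

theorem exists_sum_mul_sq_eq_zero_of_mem_sqAdjoin₂ {ι : Type} [Fintype ι]
    (hcard : 4 < Fintype.card ι) (c : ι → F) (h : ∀ j, c j ∈ sqAdjoin₂ p q) :
    ∃ x : ι → F, x ≠ 0 ∧ ∑ j, c j * x j ^ 2 = 0 := by
  choose α β γ δ hc using h
  refine exists_sum_mul_sq_eq_zero (κ := Fin 4) (by simpa) ![1, p, q, p * q] c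
    (fun j => ![α j, β j, γ j, δ j]) fun j => ?_
  rw [hc, Fin.sum_univ_four]
  simp

theorem exists_sum_mul_sq_eq_zero_of_mem_add_mul {ι : Type} [Fintype ι]
    (hcard : 8 < Fintype.card ι) (d : F) (c : ι → F)
    (h : ∀ j, ∃ m ∈ sqAdjoin₂ p q, ∃ n ∈ sqAdjoin₂ p q, c j = m + d * n) :
    ∃ x : ι → F, x ≠ 0 ∧ ∑ j, c j * x j ^ 2 = 0 := by
  choose m hm n hn hc using h
  choose α β γ δ hm using hm
  choose α' β' γ' δ' hn using hn
  refine exists_sum_mul_sq_eq_zero (κ := Fin 8) (by simpa)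
    ![1, p, q, p * q, d, d * p, d * q, d * p * q] c
    (fun j => ![α j, β j, γ j, δ j, α' j, β' j, γ' j, δ' j]) fun j => ?_
  rw [hc, hm, hn, Fin.sum_univ_eight]
  simp
  ring

theorem RatFunc.C_mem_sqAdjoin₂ {x : F} (hx : x ∈ sqAdjoin₂ p q) :
    RatFunc.C x ∈ sqAdjoin₂ (RatFunc.C p) (RatFunc.C q) := by
  obtain ⟨α, β, γ, δ, rfl⟩ := hx
  exact ⟨RatFunc.C α, RatFunc.C β, RatFunc.C γ, RatFunc.C δ, by simp⟩

omit [CharP F 2] in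
/-- Clearing denominators in a zero of an octonary form over `F(X)`. -/
theorem exists_octonary_polynomial_eq_zero {τ : F[X]} {v : Fin 8 → RatFunc F} (hv : v ≠ 0)
    (h : octonary (RatFunc.C a) (RatFunc.C b) (RatFunc.C p) (RatFunc.C q)
      (algebraMap F[X] (RatFunc F) τ) v = 0) :
    ∃ w : Fin 8 → F[X], w ≠ 0 ∧ octonary (Polynomial.C a) (Polynomial.C b) (Polynomial.C p)
      (Polynomial.C q) τ w = 0 := by
  obtain ⟨c, w, hc, hw, i, hi⟩ := exists_mul_eq_algebraMap (F := F) v hv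
  refine ⟨w, fun h0 => hi (by simp [h0]), IsFractionRing.injective F[X] (RatFunc F) ?_⟩
  rw [map_octonary, map_zero]
  simp only [RatFunc.algebraMap_C, ← hw]
  rw [octonary_smul, h, mul_zero]

omit [CharP F 2] in
theorem exists_octonary'_polynomial_eq_zero {τ : F[X]} {v : Fin 8 → RatFunc F} (hv : v ≠ 0)
    (h : octonary' (RatFunc.C a) (RatFunc.C b) (RatFunc.C p) (RatFunc.C q)
      (algebraMap F[X] (RatFunc F) τ) v = 0) :
    ∃ w : Fin 8 → F[X], w ≠ 0 ∧ octonary' (Polynomial.C a) (Polynomial.C b) (Polynomial.C p)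
      (Polynomial.C q) τ w = 0 := by
  obtain ⟨c, w, hc, hw, i, hi⟩ := exists_mul_eq_algebraMap (F := F) v hv
  refine ⟨w, fun h0 => hi (by simp [h0]), IsFractionRing.injective F[X] (RatFunc F) ?_⟩
  rw [map_octonary', map_zero]
  simp only [RatFunc.algebraMap_C, ← hw]
  rw [octonary'_smul, h, mul_zero]

variable {s : ℕ} {e : Fin s → F}

theorem SenaryAnisotropic.div_mem_or (h : SenaryAnisotropic a b p q)
    (he : (diagQF e).Anisotropic) (hi : IsotropicMod e a b p q) (i₀ i j : Fin s) :
    e i / e i₀ ∈ sqAdjoin₂ p q ∨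
      ∃ l ∈ sqAdjoin₂ p q, e j / e i₀ + l * (e i / e i₀) ∈ sqAdjoin₂ p q := by
  have h0 : e i₀ ≠ 0 := fun h0 => one_ne_zero (α := F) (by
    simpa using congrFun (he (Pi.single i₀ 1) (by
      simp [diagQF_apply, Pi.single_apply, h0])) i₀)
  obtain ⟨v, hv, hv0⟩ := (hi.map RatFunc.C).exists_octonary_eq_zero h.ratFunc.quinary
    (anisotropic_diagQF_ratFunc he)
    (algebraMap F[X] _ (Polynomial.C (e i / e i₀) + Polynomial.X ^ 2 * Polynomial.C (e j / e i₀)))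
    (fun k => (if k = i then 1 else 0) + RatFunc.X * (if k = j then 1 else 0)) (Pi.single i₀ 1)
    (Or.inr (by simp)) (by
      rw [diagQF_apply, diagQF_apply]
      simp only [CharTwo.add_sq, mul_add, Finset.sum_add_distrib]
      simp only [map_add, map_mul, map_pow, RatFunc.algebraMap_C, RatFunc.algebraMap_X]
      have hc : RatFunc.C (e i₀) ≠ 0 := by simpa using h0
      simp [Pi.single_apply]
      field_simp)
  obtain ⟨w, hw, hw0⟩ := exists_octonary_polynomial_eq_zero hv hv0
  exact h.mem_or_of_octonary hw hw0

theorem IsotropicMod.exists_octonary'_eq_zero (hi : IsotropicMod e a b p q)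
    (h : SenaryAnisotropic a b p q) (he : (diagQF e).Anisotropic) (hs : 5 ≤ s) (c d y : F)
    (hy : y ∈ sqAdjoin₂ p q)
    (hc : ∀ j, ∃ m ∈ sqAdjoin₂ p q, ∃ n ∈ sqAdjoin₂ p q, e j = c * (m + d * n)) :
    ∃ v, v ≠ 0 ∧ octonary' a b p q (d * y) v = 0 := by
  choose m hm n hn hc using hc
  let τ : F[X] := Polynomial.C p + Polynomial.X ^ 2 * Polynomial.C (d * y)
  let T : RatFunc F := algebraMap F[X] _ τ
  have hT : T = RatFunc.C p + RatFunc.X ^ 2 * RatFunc.C (d * y) := by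
    simp only [T, τ, map_add, map_mul (algebraMap F[X] (RatFunc F)), map_pow,
      RatFunc.algebraMap_C, RatFunc.algebraMap_X]
  obtain ⟨x, hx0, hx⟩ := exists_sum_mul_sq_eq_zero_of_mem_add_mul (ι := Fin s ⊕ Fin s)
    (p := RatFunc.C p) (q := RatFunc.C q) (by simp; omega) (RatFunc.C d)
    (Sum.elim (fun j => RatFunc.C (m j + d * n j)) (fun j => T * RatFunc.C (m j + d * n j))) (by
      have hM := fun j => RatFunc.C_mem_sqAdjoin₂ (hm j)
      have hN := fun j => RatFunc.C_mem_sqAdjoin₂ (hn j)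
      have hY := RatFunc.C_mem_sqAdjoin₂ hy
      have hP := left_mem_sqAdjoin₂ (RatFunc.C p) (RatFunc.C q)
      have hsq := sq_mem_sqAdjoin₂ (RatFunc.C p) (RatFunc.C q)
      rintro (j | j)
      · exact ⟨_, hM j, _, hN j, by simp⟩
      · refine ⟨_, add_mem (mul_mem hP (hM j)) (mul_mem (mul_mem (mul_mem (hsq (RatFunc.C d))
          (hsq RatFunc.X)) hY) (hN j)), _, add_mem (mul_mem hP (hN j)) (mul_mem (mul_mem
          (hsq RatFunc.X) hY) (hM j)), ?_⟩
        simp only [Sum.elim_inr, hT, map_add, map_mul]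
        ring)
  obtain ⟨v, hv, hv0⟩ := (hi.map RatFunc.C).exists_octonary_eq_zero h.ratFunc.quinary
    (anisotropic_diagQF_ratFunc he) T (fun j => x (Sum.inl j)) (fun j => x (Sum.inr j)) (by
      by_contra hcon
      push Not at hcon
      refine hx0 (funext ?_)
      rintro (j | j)
      exacts [congrFun hcon.1 j, congrFun hcon.2 j]) (by
      rw [Fintype.sum_sum_type] at hx
      simp only [Sum.elim_inl, Sum.elim_inr] at hx
      rw [diagQF_apply, diagQF_apply, ← sub_eq_zero, CharTwo.sub_eq_add, Finset.mul_sum]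
      simp only [hc, map_mul RatFunc.C c, mul_assoc, mul_left_comm T, ← Finset.mul_sum, ← mul_add]
      refine mul_eq_zero_of_right _ ((congrArg (_ + ·) ?_).trans hx)
      exact Finset.sum_congr rfl fun i _ => by ring)
  obtain ⟨w, hw, hw0⟩ := exists_octonary_polynomial_eq_zero hv hv0
  let V : Fin 8 → F[X] := ![w 0, w 1, w 2 + Polynomial.C p * w 6, w 3 + w 5, w 4, w 7,
    Polynomial.X * w 5, Polynomial.X * w 6]
  have hV : V ≠ 0 := by
    intro hV
    have h5 : w 5 = 0 := (mul_eq_zero.1 (congrFun hV 6)).resolve_left Polynomial.X_ne_zero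
    have h6 : w 6 = 0 := (mul_eq_zero.1 (congrFun hV 7)).resolve_left Polynomial.X_ne_zero
    have h2 : w 2 + Polynomial.C p * w 6 = 0 := congrFun hV 2
    have h3 : w 3 + w 5 = 0 := congrFun hV 3
    rw [h6, mul_zero, add_zero] at h2
    rw [h5, add_zero] at h3
    refine hw (funext fun i => ?_)
    fin_cases i
    exacts [congrFun hV 0, congrFun hV 1, h2, h3, congrFun hV 4, h5, h6, congrFun hV 5]
  have hV0 : octonary' (Polynomial.C a) (Polynomial.C b) (Polynomial.C p) (Polynomial.C q)
      (Polynomial.C (d * y)) V +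
      Polynomial.X ^ 2 * Polynomial.C (d * y) * Polynomial.C q * V 5 ^ 2 = 0 := by
    simp only [octonary, τ] at hw0
    simp [octonary', V, CharTwo.add_sq]
    rw [Polynomial.C_mul] at hw0
    linear_combination hw0
  obtain ⟨k, V', hk, i, hi⟩ := exists_eq_X_pow_mul V hV
  have hV1 : octonary' (Polynomial.C a) (Polynomial.C b) (Polynomial.C p) (Polynomial.C q)
      (Polynomial.C (d * y)) V' +
      Polynomial.X ^ 2 * Polynomial.C (d * y) * Polynomial.C q * V' 5 ^ 2 = 0 := by
    rw [funext hk, octonary'_smul] at hV0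
    have hX : (Polynomial.X ^ k : F[X]) ^ 2 ≠ 0 := by simp
    refine (mul_eq_zero.1 ?_).resolve_left hX
    linear_combination hV0
  have h9 := congrArg (Polynomial.evalRingHom 0) hV1
  rw [map_add, map_octonary', map_zero] at h9
  simp only [Polynomial.coe_evalRingHom, Polynomial.eval_C, Polynomial.eval_mul,
    Polynomial.eval_pow, Polynomial.eval_X, zero_pow two_ne_zero, zero_mul, add_zero] at h9
  refine ⟨_, fun h0 => hi ?_, h9⟩
  rw [Polynomial.coeff_zero_eq_eval_zero]
  exact congrFun h0 i

theorem SenaryAnisotropic.not_isotropicMod (h : SenaryAnisotropic a b p q)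
    (he : (diagQF e).Anisotropic) (hs : 5 ≤ s) : ¬ IsotropicMod e a b p q := by
  intro hi
  have h2 : (2 : F) = 0 := CharTwo.two_eq_zero
  let i₀ : Fin s := ⟨0, by omega⟩
  have h0 : e i₀ ≠ 0 := fun h0 => one_ne_zero (α := F) (by
    simpa using congrFun (he (Pi.single i₀ 1) (by
      simp [diagQF_apply, Pi.single_apply, h0])) i₀)
  obtain ⟨i, hid⟩ : ∃ i, e i / e i₀ ∉ sqAdjoin₂ p q := by
    by_contra! hcon
    obtain ⟨x, hx0, hx⟩ := exists_sum_mul_sq_eq_zero_of_mem_sqAdjoin₂ (by simp; omega) _ hcon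
    refine hx0 (he x ?_)
    rw [diagQF_apply, show ∑ k, e k * x k ^ 2 = e i₀ * ∑ k, e k / e i₀ * x k ^ 2 by
      rw [Finset.mul_sum]
      exact Finset.sum_congr rfl fun k _ => by field_simp, hx, mul_zero]
  have hd : ∀ j, ∃ m ∈ sqAdjoin₂ p q, ∃ n ∈ sqAdjoin₂ p q,
      e j = e i₀ * (m + e i / e i₀ * n) := by
    intro j
    obtain ⟨l, hl, hm⟩ := (h.div_mem_or he hi i₀ i j).resolve_left hid
    exact ⟨_, hm, l, hl, by field_simp; linear_combination (-(e i * l)) * h2⟩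
  refine hid ?_
  generalize e i / e i₀ = d at hd
  obtain ⟨v, hv, hv0⟩ := (hi.map RatFunc.C).exists_octonary'_eq_zero h.ratFunc
    (anisotropic_diagQF_ratFunc he) hs (RatFunc.C (e i₀)) (RatFunc.C d)
    (1 + RatFunc.X ^ 2 * RatFunc.C q) (add_mem (one_mem _) (mul_mem (sq_mem_sqAdjoin₂ _ _ _)
      (right_mem_sqAdjoin₂ _ _))) (fun j => by
        obtain ⟨m, hm, n, hn, hj⟩ := hd j
        exact ⟨_, RatFunc.C_mem_sqAdjoin₂ hm, _, RatFunc.C_mem_sqAdjoin₂ hn, by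
          rw [hj]; simp only [map_mul, map_add]⟩)
  have h1 : RatFunc.C d * (1 + RatFunc.X ^ 2 * RatFunc.C q) = algebraMap F[X] (RatFunc F)
      (Polynomial.C d + Polynomial.X ^ 2 * Polynomial.C (d * q)) := by
    simp only [map_add, map_mul (algebraMap F[X] (RatFunc F)), map_pow,
      RatFunc.algebraMap_C, RatFunc.algebraMap_X, map_mul]
    ring
  rw [h1] at hv0
  obtain ⟨w, hw, hw0⟩ := exists_octonary'_polynomial_eq_zero hv hv0
  exact h.mem_of_octonary' hw hw0

end

end Contradiction

section ScalarExtension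

theorem QuadraticForm.ext_single {R : Type} [CommRing R] {n : ℕ}
    {Q Q' : QuadraticForm R (Fin n → R)}
    (h : ∀ i, Q (Pi.single i 1) = Q' (Pi.single i 1))
    (hp : ∀ i j, i < j → Q (Pi.single i 1 + Pi.single j 1) = Q' (Pi.single i 1 + Pi.single j 1)) :
    Q = Q' := by
  have hp' : ∀ i j, i ≠ j → Q (Pi.single i 1 + Pi.single j 1) =
      Q' (Pi.single i 1 + Pi.single j 1) := fun i j hij => by
    rcases lt_or_gt_of_ne hij with h | h
    · exact hp i j h
    · rw [add_comm]; exact hp j i h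
  rw [← sub_eq_zero]
  ext x
  have hx : x = ∑ i, x i • (Pi.single i 1 : Fin n → R) := by
    ext j; simp [Finset.sum_apply, Pi.single_apply]
  rw [hx, QuadraticMap.map_sum]
  rw [_root_.zero_apply, Finset.sum_eq_zero, Finset.sum_eq_zero, add_zero]
  · intro ij hij
    induction ij with
    | _ i j =>
      have hne : i ≠ j := by simpa using (Finset.mem_filter.1 hij).2
      change polar (Q - Q') (x i • Pi.single i 1) (x j • Pi.single j 1) = 0
      rw [QuadraticMap.polar_smul_left, QuadraticMap.polar_smul_right]
      simp [polar, h, hp' i j hne]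
  · intro i _
    simp [QuadraticMap.map_smul, h]

theorem toQuadraticMap'_coeffMat (F : Type) [Field F] {n : ℕ} (φ : QuadraticForm F (Fin n → F)) :
    (coeffMat F φ).toQuadraticMap' = φ := by
  refine QuadraticForm.ext_single (fun i => ?_) fun i j hij => ?_
  · rw [toQuadraticMap'_apply]
    simp [Pi.single_apply, coeffMat]
  · rw [toQuadraticMap'_apply]
    simp [Pi.single_apply, coeffMat, mul_add, Finset.sum_add_distrib, hij, hij.ne,
      hij.ne', hij.not_gt, polar]

theorem extendQF_map {F K : Type} [Field F] [CommRing K] (f : F →+* K) {n : ℕ}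
    (φ : QuadraticForm F (Fin n → F)) (x : Fin n → F) :
    extendQF F f φ (fun i => f (x i)) = f (φ x) := by
  conv_rhs => rw [← toQuadraticMap'_coeffMat F φ]
  rw [extendQF, toQuadraticMap'_apply, toQuadraticMap'_apply]
  simp

theorem extendQF_eq {F K : Type} [Field F] [CommRing K] {f : F →+* K} {n : ℕ}
    {φ : QuadraticForm F (Fin n → F)} {Q : QuadraticForm K (Fin n → K)}
    (h : ∀ x : Fin n → F, Q (fun i => f (x i)) = f (φ x)) : extendQF F f φ = Q := by
  have key : ∀ x : Fin n → F, extendQF F f φ (fun i => f (x i)) = Q (fun i => f (x i)) :=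
    fun x => by rw [extendQF_map, h]
  have hs : ∀ i, (fun k => f ((Pi.single i 1 : Fin n → F) k)) = (Pi.single i 1 : Fin n → K) :=
    fun i => by ext k; simp [Pi.single_apply, apply_ite f]
  refine QuadraticForm.ext_single (fun i => ?_) fun i j _ => ?_
  · rw [← hs]; exact key _
  · rw [← hs, ← hs]
    convert key (Pi.single i 1 + Pi.single j 1) using 2 <;> ext k <;> simp

theorem qfPoly_eq_diagPoly {F : Type} [Field F] {s : ℕ} {ψ : QuadraticForm F (Fin s → F)}
    {e : Fin s → F} (h : ∀ x, ψ x = diagQF e x) : qfPoly F ψ = diagPoly e := by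
  have h1 : extendQF F (C : F →+* MvPolynomial (Fin s) F) ψ = diagQF fun i => C (e i) :=
    extendQF_eq fun x => by rw [h, diagQF_apply, diagQF_apply]; simp
  have h2 := congrArg (· X) h1
  simp only [extendQF, toQuadraticMap'_apply, diagQF_apply] at h2
  exact h2

theorem HasTypeRS.exists_eq_diagQF {F : Type} [Field F] [CharP F 2] {s : ℕ}
    {ψ : QuadraticForm F (Fin s → F)} (h : HasTypeRS ψ 0 s) :
    ∃ e : Fin s → F, ψ = diagQF e := by
  obtain ⟨a, b, c, ⟨g⟩⟩ := h
  have hg : ∀ x, ψ x = ∑ i, c i * (g.toLinearEquiv x).2 i ^ 2 := fun x => by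
    simp only [← g.map_app, QuadraticMap.prod_apply, diagQF_apply, binsQF, QuadraticMap.pi_apply,
      Finset.univ_eq_empty, Finset.sum_empty, zero_add]
    rfl
  have hadd : ∀ x y, ψ (x + y) = ψ x + ψ y := fun x y => by
    simp only [hg, map_add, Prod.snd_add, Pi.add_apply, CharTwo.add_sq, mul_add,
      Finset.sum_add_distrib]
  refine ⟨fun i => ψ (Pi.single i 1), QuadraticForm.ext_single (fun i => ?_) fun i j _ => ?_⟩
  · simp [diagQF_apply, Pi.single_apply]
  · rw [hadd, diagQF_apply]
    simp [CharTwo.add_sq, Pi.single_apply, mul_add, Finset.sum_add_distrib]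

/-- The form `[a,b] ⊥ ⟨1,p,q⟩`, as a quadratic form. -/
noncomputable def quinaryQF {R : Type} [CommRing R] (a b p q : R) : QuadraticForm R (Fin 5 → R) :=
  (binQF a b).comp (LinearMap.funLeft R R ![0, 1]) +
    (diagQF ![1, p, q]).comp (LinearMap.funLeft R R ![2, 3, 4])

theorem quinaryQF_apply {R : Type} [CommRing R] (a b p q : R) (x : Fin 5 → R) :
    quinaryQF a b p q x = quinary a b p q x := by
  simp [quinaryQF, binQF_apply, diagQF_apply, Fin.sum_univ_three, LinearMap.funLeft_apply,
    quinary]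
  ring

theorem HasTypeRS.exists_eq_mul_quinary {F : Type} [Field F]
    {φ : QuadraticForm F (Fin 5 → F)} (h : HasTypeRS φ 1 3) (hφ : φ.Anisotropic) :
    ∃ (c a b p q : F) (L : (Fin 5 → F) ≃ₗ[F] (Fin 5 → F)), c ≠ 0 ∧
      ∀ x, φ x = c * quinary a b p q (L x) := by
  obtain ⟨a, b, c, ⟨g⟩⟩ := h
  have hc : c 0 ≠ 0 := by
    intro hc
    have h1 : φ (g.symm (0, Pi.single 0 1)) = 0 := by
      rw [← g.map_app, g.apply_symm_apply]
      simp [QuadraticMap.prod_apply, diagQF_apply, Pi.single_apply, hc]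
    have h2 := congrArg g (hφ _ h1)
    rw [g.apply_symm_apply, map_zero] at h2
    simpa using congrFun (congrArg Prod.snd h2) 0
  let T : (Fin 5 → F) →ₗ[F] (Fin 5 → F) :=
    { toFun x := ![(g x).1 0 0, (c 0)⁻¹ * (g x).1 0 1, (g x).2 0, (g x).2 1, (g x).2 2]
      map_add' x y := by
        ext i; fin_cases i <;> simp [mul_add]
      map_smul' r x := by
        ext i; fin_cases i <;> simp [mul_left_comm] }
  have hT : ∀ x, φ x = c 0 * quinary (a 0 / c 0) (b 0 * c 0) (c 1 / c 0) (c 2 / c 0) (T x) := by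
    intro x
    rw [← g.map_app]
    simp [QuadraticMap.prod_apply, binsQF, QuadraticMap.pi_apply, binQF_apply, diagQF_apply,
      Fin.sum_univ_three, quinary, T]
    field_simp
    ring
  have hinj : Function.Injective T := by
    rw [injective_iff_map_eq_zero]
    intro x hx
    exact hφ x (by rw [hT, hx]; simp [quinary])
  exact ⟨_, _, _, _, _, LinearEquiv.ofInjectiveEndo T hinj, hc, hT⟩

end ScalarExtension

section PfisterNeighbour

variable {F : Type} [Field F]

theorem pfisterQF_two_apply (a : Fin 2 → F) (c : F) (x : Finset (Fin 2) → Fin 2 → F) :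
    pfisterQF 2 a c x = binQF 1 c (x ∅) + a 0 * binQF 1 c (x {0}) + a 1 * binQF 1 c (x {1}) +
      a 0 * a 1 * binQF 1 c (x {0, 1}) := by
  have hu : (Finset.univ : Finset (Finset (Fin 2))) = {∅, {0}, {1}, {0, 1}} := by decide
  rw [pfisterQF, QuadraticMap.pi_apply, hu, Finset.sum_insert (by decide),
    Finset.sum_insert (by decide), Finset.sum_insert (by decide), Finset.sum_singleton]
  simp [add_assoc]

variable [CharP F 2]

theorem senaryAnisotropic_of_not_isPfisterNeighbour {φ : QuadraticForm F (Fin 5 → F)}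
    (hφ : φ.Anisotropic) (hpn : ¬ IsPfisterNeighbour φ) {c a b p q : F}
    (L : (Fin 5 → F) ≃ₗ[F] (Fin 5 → F)) (hc : c ≠ 0)
    (hL : ∀ x, φ x = c * quinary a b p q (L x)) : SenaryAnisotropic a b p q := by
  have h2 : (2 : F) = 0 := CharTwo.two_eq_zero
  have hq : ∀ x, quinary a b p q x = 0 → x = 0 := fun x hx => by
    have h1 := hφ (L.symm x) (by rw [hL, L.apply_symm_apply, hx, mul_zero])
    simpa using h1
  have hp0 : p ≠ 0 := fun h => by
    simpa using congrFun (hq ![0, 0, 0, 1, 0] (by simpa [quinary] using h)) 3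
  have hq0 : q ≠ 0 := fun h => by
    simpa using congrFun (hq ![0, 0, 0, 0, 1] (by simpa [quinary] using h)) 4
  intro x hx
  by_contra hx0
  have h5 : x 5 ≠ 0 := by
    intro h5
    have h1 := hq ![x 0, x 1, x 2, x 3, x 4] (by
      simp only [senary, h5] at hx
      simpa [quinary] using hx)
    refine hx0 (funext fun i => ?_)
    fin_cases i
    exacts [congrFun h1 0, congrFun h1 1, congrFun h1 2, congrFun h1 3, congrFun h1 4, h5]
  obtain ⟨y, hy⟩ : ∃ y : Fin 5 → F, quinary a b p q y = p * q := by
    refine ⟨fun i => (x 5)⁻¹ * x i.castSucc, ?_⟩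
    rw [quinary_smul]
    have h1 : quinary a b p q (fun i => x i.castSucc) = p * q * x 5 ^ 2 := by
      simp only [senary] at hx
      simp only [quinary]
      exact (eq_neg_of_add_eq_zero_left hx).trans (CharTwo.neg_eq _)
    rw [h1]
    field_simp
  simp only [quinary] at hy
  obtain ⟨ξ, η, hξ⟩ : ∃ ξ η, y 0 * η + ξ * y 1 = p * q := by
    by_cases h0 : y 0 = 0
    · by_cases h1 : y 1 = 0
      · exfalso
        have h4 : y 4 ^ 2 + p = 0 := congrFun (hq ![0, 0, y 2 * y 4 + p * y 3, y 2 + y 3 * y 4,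
          y 4 ^ 2 + p] (by
            simp [quinary, CharTwo.add_sq]
            rw [h0, h1] at hy
            linear_combination (y 4 ^ 2 + p) * hy + p ^ 2 * q * h2)) 4
        simpa using congrFun (hq ![0, 0, y 4, 1, 0] (by simpa [quinary] using h4)) 3
      · exact ⟨p * q / y 1, 0, by field_simp; ring⟩
    · exact ⟨0, p * q / y 0, by field_simp; ring⟩
  let Δ := (a * ξ ^ 2 + ξ * η + b * η ^ 2) / (p * q)
  let z₀ : (Fin 5 → F) → F := fun u => (η * u 0 + ξ * u 1) / (p * q)
  let z₁ : (Fin 5 → F) → F := fun u => (y 1 * u 0 + y 0 * u 1) / (p * q)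
  have hz : ∀ u, quinary a b p q u = binQF 1 Δ ![u 2 + z₀ u * y 2, 0] +
      p * binQF 1 Δ ![u 3 + z₀ u * y 3, 0] + q * binQF 1 Δ ![u 4 + z₀ u * y 4, 0] +
      p * q * binQF 1 Δ ![z₀ u, z₁ u] := by
    intro u
    have hu0 : u 0 = z₀ u * y 0 + z₁ u * ξ := by
      simp only [z₀, z₁]
      field_simp
      linear_combination (-u 0) * hξ - ξ * u 1 * y 0 * h2
    have hu1 : u 1 = z₀ u * y 1 + z₁ u * η := by
      simp only [z₀, z₁]
      field_simp
      linear_combination (-u 1) * hξ - η * u 0 * y 1 * h2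
    have hΔ : p * q * Δ = a * ξ ^ 2 + ξ * η + b * η ^ 2 := by simp only [Δ]; field_simp
    simp [binQF_apply, quinary, CharTwo.add_sq]
    generalize z₀ u = s at *
    generalize z₁ u = t at *
    rw [hu0, hu1]
    linear_combination s ^ 2 * hy + s * t * hξ - t ^ 2 * hΔ +
      (a * s * y 0 * t * ξ + b * s * y 1 * t * η - s ^ 2 * (y 2 ^ 2 + p * y 3 ^ 2 + q * y 4 ^ 2)) * h2
  let T : (Fin 5 → F) →ₗ[F] (Finset (Fin 2) → Fin 2 → F) :=
    { toFun u S := if S = ∅ then ![u 2 + z₀ u * y 2, 0] else if S = {0} then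
        ![u 3 + z₀ u * y 3, 0] else if S = {1} then ![u 4 + z₀ u * y 4, 0] else ![z₀ u, z₁ u]
      map_add' u v := by
        ext S i
        simp only [Pi.add_apply, z₀, z₁]
        split_ifs <;> fin_cases i <;> simp <;> ring
      map_smul' r u := by
        ext S i
        simp only [Pi.smul_apply, z₀, z₁]
        split_ifs <;> fin_cases i <;> simp <;> ring }
  have hT : ∀ u, quinary a b p q u = pfisterQF 2 ![p, q] Δ (T u) := by
    intro u
    have e0 : ({0} : Finset (Fin 2)) ≠ ∅ := by decide
    have e1 : ({1} : Finset (Fin 2)) ≠ ∅ := by decide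
    have e2 : ({1} : Finset (Fin 2)) ≠ {0} := by decide
    have e3 : ({0, 1} : Finset (Fin 2)) ≠ ∅ := by decide
    have e4 : ({0, 1} : Finset (Fin 2)) ≠ {0} := by decide
    have e5 : ({0, 1} : Finset (Fin 2)) ≠ {1} := by decide
    rw [hz, pfisterQF_two_apply]
    simp only [T, LinearMap.coe_mk, AddHom.coe_mk, if_true, if_neg e0, if_neg e1, if_neg e2,
      if_neg e3, if_neg e4, if_neg e5]
    rfl
  have hdom : ∀ u, c⁻¹ * φ u = pfisterQF 2 ![p, q] Δ (T (L u)) := fun u => by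
    rw [hL, inv_mul_cancel_left₀ hc, hT]
  refine hpn ⟨2, ![Units.mk0 p hp0, Units.mk0 q hq0], Δ, by simp, (Units.mk0 c hc)⁻¹,
    T ∘ₗ L.toLinearMap, ?_, fun u => ?_⟩
  · rw [injective_iff_map_eq_zero]
    intro u hu
    refine hφ u ((mul_eq_zero.1 ?_).resolve_left (inv_ne_zero hc))
    rw [hdom]
    exact (congrArg _ hu).trans (QuadraticMap.map_zero _)
  · have e : (fun i => ((![Units.mk0 p hp0, Units.mk0 q hq0] : Fin 2 → Fˣ) i : F)) = ![p, q] := by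
      ext i; fin_cases i <;> rfl
    rw [e]
    simpa using hdom u

end PfisterNeighbour

section FunctionField

variable {F : Type} [Field F]

theorem exists_quinary_eq_zero_of_extendQF {K : Type} [CommRing K] (f : F →+* K)
    {φ : QuadraticForm F (Fin 5 → F)} {c a b p q : F} (L : (Fin 5 → F) ≃ₗ[F] (Fin 5 → F))
    (hc : c ≠ 0) (hL : ∀ x, φ x = c * quinary a b p q (L x)) {v : Fin 5 → K} (hv : v ≠ 0)
    (h : extendQF F f φ v = 0) : ∃ u ≠ 0, quinary (f a) (f b) (f p) (f q) u = 0 := by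
  let A := LinearMap.toMatrix' L.toLinearMap
  let A' := LinearMap.toMatrix' L.symm.toLinearMap
  have hA : A' * A = 1 := by
    rw [← LinearMap.toMatrix'_comp]
    simp
  have h1 : extendQF F f φ =
      f c • (quinaryQF (f a) (f b) (f p) (f q)).comp (Matrix.toLin' (A.map f)) := by
    refine extendQF_eq fun x => ?_
    rw [_root_.smul_apply, QuadraticMap.comp_apply, quinaryQF_apply, hL, map_mul, map_quinary,
      smul_eq_mul, Matrix.toLin'_apply]
    congr 2
    ext i
    rw [show L x = A.mulVec x from (LinearMap.toMatrix'_mulVec L.toLinearMap x).symm]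
    exact (RingHom.map_mulVec f A x i).symm
  rw [h1, _root_.smul_apply, QuadraticMap.comp_apply, quinaryQF_apply, smul_eq_mul] at h
  refine ⟨_, fun h0 => hv ?_, ((hc.isUnit.map f).mul_right_eq_zero.1 h)⟩
  have h3 := congrArg ((A'.map f).mulVec) h0
  rwa [Matrix.toLin'_apply, Matrix.mulVec_mulVec, ← Matrix.map_mul, hA,
    Matrix.map_one _ f.map_zero f.map_one, Matrix.one_mulVec, Matrix.mulVec_zero] at h3

theorem isotropicMod_of_quinary_eq_zero {s : ℕ} {ψ : QuadraticForm F (Fin s → F)} {e : Fin s → F}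
    (hψ : qfPoly F ψ = diagPoly e) {a b p q : F} {u : Fin 5 → FunField F ψ} (hu : u ≠ 0)
    (h : quinary (funFieldMap F ψ a) (funFieldMap F ψ b) (funFieldMap F ψ p)
      (funFieldMap F ψ q) u = 0) : IsotropicMod e a b p q := by
  let π : MvPolynomial (Fin s) F →+* FunFieldRing F ψ := Ideal.Quotient.mk _
  have hπ : ∀ g, π g = 0 ↔ diagPoly e ∣ g := fun g => by
    rw [← hψ, ← Ideal.mem_span_singleton]
    exact Ideal.Quotient.eq_zero_iff_mem
  let j : FunFieldRing F ψ →+* FunField F ψ := algebraMap (FunFieldRing F ψ) (FractionRing _)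
  have hj : Function.Injective j := IsFractionRing.injective (FunFieldRing F ψ) (FractionRing _)
  have hf : ∀ x, funFieldMap F ψ x = j (π (C x)) := fun x => rfl
  obtain ⟨d, hd⟩ := IsLocalization.exist_integer_multiples (S := FractionRing (FunFieldRing F ψ))
    (nonZeroDivisors (FunFieldRing F ψ)) Finset.univ u
  choose w hw using fun i => hd i (Finset.mem_univ i)
  have hw' : ∀ i, j (w i) = j d * u i := fun i => (hw i).trans (Algebra.smul_def _ _)
  choose g hg using fun i => Ideal.Quotient.mk_surjective (w i)
  have hg' : ∀ i, π (g i) = w i := hg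
  refine ⟨g, (hπ _).1 (hj ?_), ?_⟩
  · rw [map_quinary, map_quinary, map_zero]
    simp only [hg', hw', ← hf]
    rw [quinary_smul, h, mul_zero]
  · by_contra! hcon
    refine hu (funext fun i => ?_)
    have h1 := hw' i
    rw [← hg' i, (hπ _).2 (hcon i), map_zero] at h1
    have hunit : IsUnit (j d) := IsLocalization.map_units (FractionRing (FunFieldRing F ψ)) d
    exact hunit.mul_right_eq_zero.1 h1.symm

end FunctionField

theorem stmt0 (F : Type) [Field F] [CharP F 2]
    (φ : QuadraticForm F (Fin 5 → F)) (hφa : φ.Anisotropic) (hφt : HasTypeRS φ 1 3)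
    (hφpn : ¬ IsPfisterNeighbour φ)
    (s : ℕ) (hs : 5 ≤ s) (ψ : QuadraticForm F (Fin s → F))
    (hψa : ψ.Anisotropic) (hψt : HasTypeRS ψ 0 s) :
    (extendQF F (funFieldMap F ψ) φ).Anisotropic := by
  intro v hv
  by_contra hv0
  obtain ⟨c, a, b, p, q, L, hc, hL⟩ := hφt.exists_eq_mul_quinary hφa
  obtain ⟨e, rfl⟩ := hψt.exists_eq_diagQF
  obtain ⟨u, hu, hu0⟩ := exists_quinary_eq_zero_of_extendQF _ L hc hL hv0 hv
  exact (senaryAnisotropic_of_not_isPfisterNeighbour hφa hφpn L hc hL).not_isotropicMod hψa hs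
    (isotropicMod_of_quinary_eq_zero (qfPoly_eq_diagPoly fun _ => rfl) hu hu0)
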